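/- Fix λ ∈ {1, −1, i, −i}. For every φ ∈ C_c^∞(ℝ) that is not identically zero, there exist y ∈ ℝ and a crystalline measure η on ℝ satisfying η̂ = λη (as tempered distributions) such that, with ψ(x) := e^{2πi x y} φ(x), the convolution η*ψ is not a Bohr almost periodic function. Consequently, η is not strongly almost periodic as a distribution, η is not translation bounded as a distribution, and η is not a strongly tempered measure. -/

import Mathlib

set_option linter.unusedSectionVars false

open MeasureTheory Filter Metric Complex SchwartzMap
open scoped Topology ENNReal NNReal ComplexConjugate

noncomputable section

section Preamble

variable {E : Type*} [NormedAddCommGroup E] [InnerProductSpace ℝ E] [FiniteDimensional ℝ E]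
  [MeasurableSpace E] [BorelSpace E]

/-- A set is relatively dense if it has bounded gaps. -/
def IsRelativelyDense (A : Set E) : Prop :=
  ∃ r : ℝ, ∀ x : E, ∃ a ∈ A, dist x a ≤ r

/-- Bohr almost periodic functions: uniformly continuous, bounded, with relatively
dense sets of ε-almost periods. -/
def IsBohrAP (f : E → ℂ) : Prop :=
  UniformContinuous f ∧ (∃ C : ℝ, ∀ x, ‖f x‖ ≤ C) ∧
    ∀ ε : ℝ, 0 < ε → IsRelativelyDense {t : E | ∀ x, ‖f (x - t) - f x‖ < ε}

/-- Bounded functions. -/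
def IsBddFun (f : E → ℂ) : Prop := ∃ C : ℝ, ∀ x, ‖f x‖ ≤ C

lemma isometry_const_sub (x : E) : Isometry (fun y : E => x - y) :=
  Isometry.of_dist_eq (fun a b => dist_sub_left x a b)

lemma hasTemperateGrowth_const_sub (x : E) :
    Function.HasTemperateGrowth (fun y : E => x - y) := by
  apply Function.HasTemperateGrowth.of_fderiv (k := 1) (C := ‖x‖ + 1)
  · have h : (fderiv ℝ (fun y : E => x - y)) =
        fun _ : E => ((0 : E →L[ℝ] E) - ContinuousLinearMap.id ℝ E) := by
      funext y
      exact ((hasFDerivAt_const x y).sub (hasFDerivAt_id y)).fderiv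
    rw [h]
    exact Function.HasTemperateGrowth.const _
  · exact (differentiable_const x).sub differentiable_id
  · intro y
    have h1 : ‖x - y‖ ≤ ‖x‖ + ‖y‖ := norm_sub_le x y
    have h2 : (0:ℝ) ≤ ‖x‖ := norm_nonneg x
    have h3 : (0:ℝ) ≤ ‖y‖ := norm_nonneg y
    calc ‖x - y‖ ≤ ‖x‖ + ‖y‖ := h1
      _ ≤ (‖x‖ + 1) * (1 + ‖y‖) ^ 1 := by nlinarith

/-- The reflected translate `y ↦ ψ (x - y)` of a Schwartz function. -/
def transRefl (x : E) (ψ : SchwartzMap E ℂ) : SchwartzMap E ℂ :=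
  SchwartzMap.compCLMOfAntilipschitz (K := 1) ℝ (hasTemperateGrowth_const_sub x)
    (isometry_const_sub x).antilipschitz ψ

@[simp] lemma transRefl_apply (x : E) (ψ : SchwartzMap E ℂ) (y : E) :
    transRefl x ψ y = ψ (x - y) := rfl

/-- Convolution of a tempered distribution with a Schwartz function:
`(T * ψ)(x) = T (ψ (x - ·))`. -/
def convTD (T : SchwartzMap E ℂ →L[ℂ] ℂ) (ψ : SchwartzMap E ℂ) : E → ℂ :=
  fun x => T (transRefl x ψ)

/-- Smooth compactly supported test function, regarded inside the Schwartz space. -/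
def IsTestFn (φ : SchwartzMap E ℂ) : Prop := HasCompactSupport ⇑φ

/-- Translation bounded as a tempered distribution. -/
def TransBddTD (T : SchwartzMap E ℂ →L[ℂ] ℂ) : Prop :=
  ∀ ψ : SchwartzMap E ℂ, IsBddFun (convTD T ψ)

/-- Translation bounded as a distribution. -/
def TransBddD (T : SchwartzMap E ℂ →L[ℂ] ℂ) : Prop :=
  ∀ ψ : SchwartzMap E ℂ, IsTestFn ψ → IsBddFun (convTD T ψ)

/-- Strongly almost periodic as a tempered distribution. -/
def SAPTD (T : SchwartzMap E ℂ →L[ℂ] ℂ) : Prop :=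
  ∀ ψ : SchwartzMap E ℂ, IsBohrAP (convTD T ψ)

/-- Strongly almost periodic as a distribution. -/
def SAPD (T : SchwartzMap E ℂ →L[ℂ] ℂ) : Prop :=
  ∀ ψ : SchwartzMap E ℂ, IsTestFn ψ → IsBohrAP (convTD T ψ)

/-- The distributional Fourier transform, `T̂(φ) = T(φ̂)`, with the convention
`φ̂(ξ) = ∫ e^{-2πi⟨x,ξ⟩} φ(x) dx`. -/
def fourierTD (T : SchwartzMap E ℂ →L[ℂ] ℂ) : SchwartzMap E ℂ →L[ℂ] ℂ :=
  T.comp (SchwartzMap.fourierTransformCLM ℂ)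

/-- A complex Radon measure, encoded by its total variation measure together with a
unimodular density (polar decomposition). -/
structure CMeasure (E : Type*) [TopologicalSpace E] [MeasurableSpace E] where
  /-- the total variation measure -/
  tv : Measure E
  locFin : IsLocallyFiniteMeasure tv
  /-- the unimodular density -/
  density : E → ℂ
  density_meas : Measurable density
  density_norm : ∀ᵐ x ∂tv, ‖density x‖ = 1

namespace CMeasure

/-- Pairing of a complex measure with a function: `μ(φ) = ∫ φ dμ`. -/
def pairing (μ : CMeasure E) (φ : E → ℂ) : ℂ := ∫ x, φ x * μ.density x ∂μ.tv

/-- The complex measure agrees with the tempered distribution `T` on all smooth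
compactly supported test functions; i.e. `μ` is a tempered measure identified with `T`. -/
def Agrees (μ : CMeasure E) (T : SchwartzMap E ℂ →L[ℂ] ℂ) : Prop :=
  ∀ φ : SchwartzMap E ℂ, IsTestFn φ → T φ = μ.pairing ⇑φ

/-- A tempered measure is one that extends to a tempered distribution. -/
def IsTempered (μ : CMeasure E) : Prop := ∃ T, μ.Agrees T

/-- Pure point measure: concentrated on a countable set. -/
def IsPurePoint (μ : CMeasure E) : Prop := ∃ S : Set E, S.Countable ∧ μ.tv Sᶜ = 0

/-- Convolution of a complex measure with a function: `(μ * φ)(x) = ∫ φ(x - y) dμ(y)`. -/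
def convM (μ : CMeasure E) (φ : E → ℂ) : E → ℂ :=
  fun x => ∫ y, φ (x - y) * μ.density y ∂μ.tv

/-- Translation bounded as a measure. -/
def TransBddM (μ : CMeasure E) : Prop :=
  ∀ φ : E → ℂ, Continuous φ → HasCompactSupport φ → IsBddFun (μ.convM φ)

/-- Strongly almost periodic as a measure. -/
def SAPM (μ : CMeasure E) : Prop :=
  ∀ φ : E → ℂ, Continuous φ → HasCompactSupport φ → IsBohrAP (μ.convM φ)

/-- Strongly tempered measure: the total variation has polynomial growth,
equivalently `|μ|` is a tempered (slowly increasing) measure. -/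
def IsStronglyTempered (μ : CMeasure E) : Prop :=
  ∃ C a : ℝ, ∀ r : ℝ, 1 ≤ r → μ.tv (Metric.closedBall 0 r) ≤ ENNReal.ofReal (C * r ^ a)

/-- The atom of a complex measure at a point: `μ({x})`. -/
def atom (μ : CMeasure E) (x : E) : ℂ := (μ.tv {x}).toReal • μ.density x

/-- The measure is concentrated on a locally finite set. -/
def LocallyFiniteSupport (μ : CMeasure E) : Prop :=
  ∃ S : Set E, (∀ K : Set E, IsCompact K → (S ∩ K).Finite) ∧ μ.tv Sᶜ = 0

end CMeasure

end Preamble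

section Helpers1
open FourierTransform

lemma hx_fourier_eq (f : SchwartzMap ℝ ℂ) (s : ℝ) :
    SchwartzMap.fourierTransformCLM ℂ f s =
      ∫ v : ℝ, Complex.exp (((-2 * Real.pi * v * s : ℝ) : ℂ) * Complex.I) * f v := by
  rw [SchwartzMap.fourierTransformCLM_apply, SchwartzMap.fourier_coe,
    Real.fourier_real_eq_integral_exp_smul]
  simp [smul_eq_mul]

lemma hx_fourier_shift (f : SchwartzMap ℝ ℂ) (e s : ℝ) :
    SchwartzMap.fourierTransformCLM ℂ (f.compSubConstCLM ℂ e) s =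
      Complex.exp (((-2 * Real.pi * e * s : ℝ) : ℂ) * Complex.I) *
        SchwartzMap.fourierTransformCLM ℂ f s := by
  rw [hx_fourier_eq, hx_fourier_eq, ← integral_const_mul,
    ← integral_add_right_eq_self _ e]
  congr 1
  ext v
  rw [← mul_assoc, ← Complex.exp_add, SchwartzMap.compSubConstCLM_apply, add_sub_cancel_right]
  congr 2
  push_cast
  ring

lemma hx_fourier_fourier (f : SchwartzMap ℝ ℂ) (s : ℝ) :
    SchwartzMap.fourierTransformCLM ℂ (SchwartzMap.fourierTransformCLM ℂ f) s = f (-s) := by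
  have h : (𝓕⁻ (𝓕 f)) = f := FourierTransform.fourierInv_fourier_eq f
  have h2 : (𝓕⁻ (𝓕 f)) (-s) = f (-s) := by rw [h]
  rw [← h2, SchwartzMap.fourierInv_apply_eq]
  simp [SchwartzMap.fourierTransformCLM_apply]

lemma hx_fourier_transRefl (f : SchwartzMap ℝ ℂ) (x s : ℝ) :
    ‖SchwartzMap.fourierTransformCLM ℂ (transRefl x f) s‖ =
      ‖SchwartzMap.fourierTransformCLM ℂ f (-s)‖ := by
  have : SchwartzMap.fourierTransformCLM ℂ (transRefl x f) s =
      Complex.exp (((-2 * Real.pi * x * s : ℝ) : ℂ) * Complex.I) *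
        SchwartzMap.fourierTransformCLM ℂ f (-s) := by
    rw [hx_fourier_eq, hx_fourier_eq, ← integral_const_mul,
      ← integral_sub_left_eq_self _ volume x]
    congr 1
    ext v
    rw [← mul_assoc, ← Complex.exp_add, transRefl_apply, sub_sub_cancel]
    congr 2
    push_cast
    ring
  rw [this, norm_mul, Complex.norm_exp_ofReal_mul_I, one_mul]

/-- dilation -/
lemma hx_dil (f : SchwartzMap ℝ ℂ) (L : ℝ) (hL : 0 < L) :
    ∃ g : SchwartzMap ℝ ℂ, ∀ x, g x = f (L * x) := by
  refine ⟨SchwartzMap.compCLMOfContinuousLinearEquiv ℂ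
    (ContinuousLinearEquiv.unitsEquivAut ℝ (Units.mk0 L hL.ne')) f, fun x => ?_⟩
  simp [mul_comm]

lemma hx_poisson (f : SchwartzMap ℝ ℂ) (L p : ℝ) (hL : 0 < L) :
    ∑' k : ℤ, SchwartzMap.fourierTransformCLM ℂ f (p + L * k) =
      ∑' k : ℤ, ((1 / L : ℝ) : ℂ) *
        Complex.exp (((-2 * Real.pi * (k / L) * p : ℝ) : ℂ) * Complex.I) * f (k / L) := by
  obtain ⟨g, hg⟩ := hx_dil (SchwartzMap.fourierTransformCLM ℂ f) L hL
  have h := SchwartzMap.tsum_eq_tsum_fourier g (p / L)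
  have h1 : ∀ n : ℤ, g (p / L + n) = SchwartzMap.fourierTransformCLM ℂ f (p + L * n) := by
    intro n
    rw [hg]; congr 1; field_simp
  have h2 : ∀ s : ℝ, (𝓕 g) s = ((1 / L : ℝ) : ℂ) * f (-(s / L)) := by
    intro s
    rw [← SchwartzMap.fourierTransformCLM_apply ℂ, hx_fourier_eq, ← hx_fourier_fourier,
      hx_fourier_eq]
    have := Measure.integral_comp_mul_left (fun v : ℝ =>
      Complex.exp (((-2 * Real.pi * v * (s / L) : ℝ) : ℂ) * Complex.I) *
        SchwartzMap.fourierTransformCLM ℂ f v) L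
    rw [abs_of_pos (inv_pos.2 hL)] at this
    rw [one_div, ← Complex.real_smul, ← this]
    congr 1
    ext v
    rw [hg]
    congr 4
    field_simp
  simp only [h1, h2] at h
  rw [h, ← (Equiv.neg ℤ).tsum_eq]
  congr 1
  ext k
  rw [fourier_coe_apply]
  have e1 : (-(((Equiv.neg ℤ) k : ℤ) : ℝ) / L) = k / L := by simp
  have e2 : -((((Equiv.neg ℤ) k : ℤ) : ℝ) / L) = k / L := by simp [neg_div]
  rw [e2, mul_right_comm]
  congr 3
  simp
  ring

end Helpers1

section Helpers2

/-- The continuous seminorm used throughout. -/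
def qS : Seminorm ℂ (SchwartzMap ℝ ℂ) :=
  (Finset.Iic ((3, 1) : ℕ × ℕ)).sup (fun m => SchwartzMap.seminorm ℂ m.1 m.2)

lemma qS_continuous : Continuous qS := by
  have h := (schwartz_withSeminorms ℂ ℝ ℂ)
  refine Seminorm.continuous' (r := 1) ?_
  rw [h.mem_nhds_iff]
  exact ⟨Finset.Iic ((3, 1) : ℕ × ℕ), 1, one_pos, Seminorm.ball_subset_closedBall _ _ _⟩

lemma qS_zero (f : SchwartzMap ℝ ℂ) (x : ℝ) : (1 + |x|) ^ 3 * ‖f x‖ ≤ 8 * qS f := by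
  have := SchwartzMap.one_add_le_sup_seminorm_apply (𝕜 := ℂ) (m := (3, 1)) (k := 3) (n := 0)
    le_rfl (by norm_num) f x
  rw [norm_iteratedFDeriv_zero, Real.norm_eq_abs] at this
  norm_num at this
  exact this

lemma qS_one (f : SchwartzMap ℝ ℂ) (x : ℝ) : (1 + |x|) ^ 2 * ‖deriv f x‖ ≤ 8 * qS f := by
  have := SchwartzMap.one_add_le_sup_seminorm_apply (𝕜 := ℂ) (m := (3, 1)) (k := 2) (n := 1)
    (by norm_num) le_rfl f x
  rw [norm_iteratedFDeriv_eq_norm_iteratedDeriv, iteratedDeriv_one, Real.norm_eq_abs] at this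
  norm_num at this
  exact this

lemma qS_diff (f : SchwartzMap ℝ ℂ) (s e : ℝ) (he : 0 < e) (he1 : e ≤ 1) :
    ‖f (s + e) - f (s - e)‖ ≤ 2 * e * (32 * qS f * ((1 + |s|) ^ 2)⁻¹) := by
  have key : ∀ t ∈ Set.Icc (s - e) (s + e), ‖deriv f t‖ ≤ 32 * qS f * ((1 + |s|) ^ 2)⁻¹ := by
    intro t ht
    have h1 := qS_one f t
    have h2 : (1 + |s|) ≤ 2 * (1 + |t|) := by
      have : |s| ≤ |t| + |s - t| := by
        have := abs_add_le t (s - t); simpa using this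
      have h3 : |s - t| ≤ 1 := abs_le.2 ⟨by linarith [ht.2], by linarith [ht.1]⟩
      have := abs_nonneg t
      linarith
    have h0 : 0 < 1 + |s| := by positivity
    rw [← div_eq_mul_inv, le_div_iff₀ (by positivity)]
    have h4 : (1 + |s|) ^ 2 ≤ 4 * (1 + |t|) ^ 2 := by nlinarith [abs_nonneg t]
    nlinarith [norm_nonneg (deriv f t)]
  have := Convex.norm_image_sub_le_of_norm_deriv_le (𝕜 := ℝ) (f := f) (s := Set.Icc (s - e) (s + e))
    (x := s - e) (y := s + e) (fun x _ => f.differentiableAt) key (convex_Icc _ _)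
    ⟨le_rfl, by linarith⟩ ⟨by linarith, le_rfl⟩
  refine this.trans (le_of_eq ?_)
  have : (s + e) - (s - e) = 2 * e := by ring
  rw [this, Real.norm_eq_abs, abs_of_pos (by linarith : (0 : ℝ) < 2 * e)]
  ring

/-- translation bounded weights -/
def TB (w : ℝ → ℂ) : Prop :=
  ∃ K : ℝ, ∀ (x : ℝ) (F : Finset ℝ), ∑ s ∈ F, ‖w s‖ * ((1 + |x - s|) ^ 2)⁻¹ ≤ K

lemma TB.add {w v : ℝ → ℂ} (hw : TB w) (hv : TB v) : TB (fun s => w s + v s) := by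
  obtain ⟨K, hK⟩ := hw
  obtain ⟨M, hM⟩ := hv
  refine ⟨K + M, fun x F => ?_⟩
  refine le_trans ?_ (add_le_add (hK x F) (hM x F))
  rw [← Finset.sum_add_distrib]
  refine Finset.sum_le_sum fun s _ => ?_
  rw [← add_mul]
  gcongr
  exact norm_add_le _ _

lemma TB.mul {w : ℝ → ℂ} (hw : TB w) (c : ℂ) : TB (fun s => c * w s) := by
  obtain ⟨K, hK⟩ := hw
  refine ⟨‖c‖ * K, fun x F => ?_⟩
  refine le_trans (le_of_eq ?_) (mul_le_mul_of_nonneg_left (hK x F) (norm_nonneg c))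
  rw [Finset.mul_sum]
  refine Finset.sum_congr rfl fun s _ => ?_
  rw [norm_mul, mul_assoc]

lemma TB.sum {ι : Type*} (t : Finset ι) (w : ι → ℝ → ℂ) (h : ∀ i ∈ t, TB (w i)) :
    TB (fun s => ∑ i ∈ t, w i s) := by
  classical
  induction t using Finset.induction_on with
  | empty => exact ⟨0, fun x F => by simp⟩
  | insert a t ha ih =>
    simp only [Finset.sum_insert ha]
    exact (h a (Finset.mem_insert_self _ _)).add (ih fun i hi => h i (Finset.mem_insert_of_mem hi))

lemma TB_comb (w : ℝ → ℂ) (p h B : ℝ) (hh : 0 < h) (hB : ∀ s, ‖w s‖ ≤ B)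
    (hw : ∀ s, w s ≠ 0 → ∃ k : ℤ, s = p + h * k) : TB w := by
  have hB0 : 0 ≤ B := (norm_nonneg _).trans (hB 0)
  have hsum : Summable (fun j : ℤ => B * (1 + h) ^ 2 * ((1 + h * |(j : ℝ)|) ^ 2)⁻¹) := by
    apply Summable.mul_left
    have h1 : Summable (fun j : ℤ => (h ^ 2)⁻¹ * (1 / (j : ℝ) ^ 2)) :=
      (Real.summable_one_div_int_pow.2 (by norm_num)).mul_left _
    refine Summable.of_norm_bounded_eventually h1 ?_
    have : {j : ℤ | ¬ ‖((1 + h * |(j : ℝ)|) ^ 2)⁻¹‖ ≤ (h ^ 2)⁻¹ * (1 / (j : ℝ) ^ 2)} ⊆ {0} := by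
      intro j hj
      by_contra hj0
      apply hj
      have hj1 : 0 < |(j : ℝ)| := abs_pos.2 (by exact_mod_cast hj0)
      rw [one_div, ← mul_inv, norm_inv, norm_pow, Real.norm_eq_abs,
        abs_of_pos (by positivity : 0 < 1 + h * |(j : ℝ)|)]
      have : h ^ 2 * (j : ℝ) ^ 2 = (h * |(j : ℝ)|) ^ 2 := by rw [mul_pow, sq_abs]
      rw [this]
      gcongr
      linarith
    exact (Set.finite_singleton (0 : ℤ)).subset this
  refine ⟨∑' j : ℤ, B * (1 + h) ^ 2 * ((1 + h * |(j : ℝ)|) ^ 2)⁻¹, fun x F => ?_⟩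
  set k0 : ℤ := ⌊(x - p) / h⌋ with hk0
  set i : ℤ → ℝ := fun k => p + h * ((k + k0 : ℤ) : ℝ) with hi
  have hinj : Function.Injective i := by
    intro a b hab
    simp only [hi] at hab
    have := mul_left_cancel₀ hh.ne' (add_left_cancel hab)
    have : a + k0 = b + k0 := by exact_mod_cast this
    omega
  have hle : ∀ k : ℤ, ‖w (i k)‖ * ((1 + |x - i k|) ^ 2)⁻¹ ≤
      B * (1 + h) ^ 2 * ((1 + h * |(k : ℝ)|) ^ 2)⁻¹ := by
    intro k
    have h1 : (k0 : ℝ) ≤ (x - p) / h := Int.floor_le _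
    have h2 : (x - p) / h < k0 + 1 := Int.lt_floor_add_one _
    rw [le_div_iff₀ hh] at h1
    rw [div_lt_iff₀ hh] at h2
    have h3 : 1 + h * |(k : ℝ)| ≤ (1 + h) * (1 + |x - i k|) := by
      have h4 : h * |(k : ℝ)| = |h * k| := by rw [abs_mul, abs_of_pos hh]
      have h5 : |h * (k : ℝ)| ≤ |x - i k| + h := by
        have e : x - i k = (x - p - k0 * h) - h * k := by simp only [hi]; push_cast; ring
        have h6 : |h * (k : ℝ)| ≤ |x - i k| + |x - p - k0 * h| := by
          have : h * (k : ℝ) = (x - p - k0 * h) - (x - i k) := by rw [e]; ring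
          rw [this, add_comm]
          exact abs_sub _ _
        have h7 : |x - p - k0 * h| ≤ h := by rw [abs_le]; constructor <;> nlinarith
        linarith
      have := abs_nonneg (x - i k)
      nlinarith
    have h4 : (1 + h * |(k : ℝ)|) ^ 2 ≤ (1 + h) ^ 2 * (1 + |x - i k|) ^ 2 := by
      rw [← mul_pow]; gcongr
    have h5 : ((1 + |x - i k|) ^ 2)⁻¹ ≤ (1 + h) ^ 2 * ((1 + h * |(k : ℝ)|) ^ 2)⁻¹ := by
      rw [inv_le_iff_one_le_mul₀ (by positivity), ← div_eq_mul_inv, div_mul_eq_mul_div,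
        le_div_iff₀ (by positivity), one_mul]
      exact h4
    rw [mul_assoc]
    exact mul_le_mul (hB _) h5 (by positivity) hB0
  have hs1 : Summable (fun k : ℤ => ‖w (i k)‖ * ((1 + |x - i k|) ^ 2)⁻¹) :=
    Summable.of_nonneg_of_le (fun k => by positivity) hle hsum
  have hoff : ∀ s ∉ Set.range i, ‖w s‖ * ((1 + |x - s|) ^ 2)⁻¹ = 0 := by
    intro s hs
    have : w s = 0 := by
      by_contra h0
      obtain ⟨k, hk⟩ := hw s h0
      exact hs ⟨k - k0, by simp only [hi]; rw [hk]; push_cast; ring⟩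
    simp [this]
  have hH := (hinj.hasSum_iff hoff).1 hs1.hasSum
  refine (sum_le_hasSum F (fun s _ => by positivity) hH).trans ?_
  exact hs1.tsum_le_tsum hle hsum

lemma TB.summable {w : ℝ → ℂ} (hw : TB w) (x : ℝ) :
    Summable (fun s => ‖w s‖ * ((1 + |x - s|) ^ 2)⁻¹) := by
  obtain ⟨K, hK⟩ := hw
  exact summable_of_sum_le (fun s => by positivity) (hK x)

lemma TB.tsum_le {w : ℝ → ℂ} (hw : TB w) :
    ∃ K : ℝ, 0 ≤ K ∧ ∀ x, ∑' s, ‖w s‖ * ((1 + |x - s|) ^ 2)⁻¹ ≤ K := by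
  have h := hw
  obtain ⟨K, hK⟩ := hw
  refine ⟨K, by simpa using hK 0 ∅, fun x => ?_⟩
  exact Real.tsum_le_of_sum_le (fun s => by positivity) (hK x)

/-- A distribution is represented by a weight function. -/
def WRep (T : SchwartzMap ℝ ℂ →L[ℂ] ℂ) (w : ℝ → ℂ) : Prop :=
  ∀ f : SchwartzMap ℝ ℂ, HasSum (fun s => w s * f s) (T f)

lemma hx_mkCLM (T : SchwartzMap ℝ ℂ →ₗ[ℂ] ℂ) (K : ℝ)
    (h : ∀ f, ‖T f‖ ≤ K * qS f) :
    ∃ S : SchwartzMap ℝ ℂ →L[ℂ] ℂ, ∀ f, S f = T f := by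
  refine ⟨⟨T, ?_⟩, fun f => rfl⟩
  have hc : Continuous (fun f => K * qS f) := continuous_const.mul qS_continuous
  refine continuous_of_continuousAt_zero T ?_
  rw [ContinuousAt, map_zero, tendsto_zero_iff_norm_tendsto_zero]
  refine squeeze_zero (fun _ => norm_nonneg _) h ?_
  have := hc.tendsto 0
  simpa using this

lemma hx_exists_T (w : ℝ → ℂ) (K : ℝ)
    (h : ∀ f : SchwartzMap ℝ ℂ, Summable (fun s => w s * f s) ∧
      ‖∑' s, w s * f s‖ ≤ K * qS f) :
    ∃ T : SchwartzMap ℝ ℂ →L[ℂ] ℂ, WRep T w ∧ ∀ f, ‖T f‖ ≤ K * qS f := by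
  let T : SchwartzMap ℝ ℂ →ₗ[ℂ] ℂ :=
    { toFun := fun f => ∑' s, w s * f s
      map_add' := by
        intro f g
        rw [← (h f).1.tsum_add (h g).1]
        congr 1; ext s; simp [mul_add]
      map_smul' := by
        intro c f
        simp only [RingHom.id_apply, smul_eq_mul]
        rw [← tsum_mul_left]
        congr 1; ext s; simp; ring }
  obtain ⟨S, hS⟩ := hx_mkCLM T K (fun f => (h f).2)
  refine ⟨S, fun f => ?_, fun f => ?_⟩
  · rw [hS]; exact (h f).1.hasSum
  · rw [hS]; exact (h f).2

end Helpers2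

section Helpers3

/-- locally finite support of a weight -/
def LF (w : ℝ → ℂ) : Prop := ∀ r : ℝ, {s : ℝ | |s| ≤ r ∧ w s ≠ 0}.Finite

lemma LF.add {w v : ℝ → ℂ} (hw : LF w) (hv : LF v) : LF (fun s => w s + v s) := by
  intro r
  refine ((hw r).union (hv r)).subset ?_
  rintro s ⟨h1, h2⟩
  by_cases h : w s = 0
  · right; refine ⟨h1, fun h3 => h2 ?_⟩; simp [h, h3]
  · left; exact ⟨h1, h⟩

lemma LF.mul {w : ℝ → ℂ} (hw : LF w) (c : ℝ → ℂ) : LF (fun s => c s * w s) := by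
  intro r
  refine (hw r).subset ?_
  rintro s ⟨h1, h2⟩
  exact ⟨h1, fun h3 => h2 (by simp [h3])⟩

lemma LF.sum {ι : Type*} (t : Finset ι) (w : ι → ℝ → ℂ) (h : ∀ i ∈ t, LF (w i)) :
    LF (fun s => ∑ i ∈ t, w i s) := by
  classical
  induction t using Finset.induction_on with
  | empty => intro r; simp
  | insert a t ha ih =>
    simp only [Finset.sum_insert ha]
    exact (h a (Finset.mem_insert_self _ _)).add (ih fun i hi => h i (Finset.mem_insert_of_mem hi))

lemma LF.shift {w : ℝ → ℂ} (hw : LF w) (e : ℝ) : LF (fun s => w (s + e)) := by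
  intro r
  refine ((hw (r + |e|)).image (fun s => s - e)).subset ?_
  rintro s ⟨h1, h2⟩
  refine ⟨s + e, ⟨?_, h2⟩, by simp⟩
  exact (abs_add_le _ _).trans (by linarith)

lemma LF_comb (w : ℝ → ℂ) (p h : ℝ) (hh : 0 < h)
    (hw : ∀ s, w s ≠ 0 → ∃ k : ℤ, s = p + h * k) : LF w := by
  intro r
  refine ((Set.finite_Icc (⌊(-r - p) / h⌋) (⌈(r - p) / h⌉)).image
    (fun k : ℤ => p + h * k)).subset ?_
  rintro s ⟨h1, h2⟩
  obtain ⟨k, hk⟩ := hw s h2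
  have h3 := abs_le.1 h1
  refine ⟨k, ⟨?_, ?_⟩, hk.symm⟩
  · have : ((⌊(-r - p) / h⌋ : ℤ) : ℝ) ≤ k := (Int.floor_le _).trans (by
      rw [div_le_iff₀ hh]; linarith)
    exact_mod_cast this
  · have : (k : ℝ) ≤ ((⌈(r - p) / h⌉ : ℤ) : ℝ) := le_trans (by
      rw [le_div_iff₀ hh]; linarith) (Int.le_ceil _)
    exact_mod_cast this

lemma TB.norm_summable_mul {w : ℝ → ℂ} (hw : TB w) (f : SchwartzMap ℝ ℂ) :
    Summable (fun s => ‖w s * f s‖) := by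
  refine Summable.of_nonneg_of_le (fun _ => norm_nonneg _) (fun s => ?_)
    ((hw.summable 0).mul_right (8 * qS f))
  rw [norm_mul, zero_sub, abs_neg, mul_assoc]
  gcongr
  have h1 := qS_zero f s
  rw [inv_mul_eq_div, le_div_iff₀ (by positivity)]
  have : (1 + |s|) ^ 2 ≤ (1 + |s|) ^ 3 := pow_le_pow_right₀ (by linarith [abs_nonneg s]) (by norm_num)
  nlinarith [norm_nonneg (f s)]

lemma TB.summable_mul {w : ℝ → ℂ} (hw : TB w) (f : SchwartzMap ℝ ℂ) :
    Summable (fun s => w s * f s) := (hw.norm_summable_mul f).of_norm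

open Classical in
/-- Dirac comb weight -/
def cA (L p s : ℝ) : ℂ := if ∃ k : ℤ, s = p + L * k then 1 else 0

open Classical in
/-- dual weight of a Dirac comb -/
def cB (L p s : ℝ) : ℂ := if ∃ k : ℤ, s = 0 + L⁻¹ * k then
  ((1 / L : ℝ) : ℂ) * Complex.exp (((-2 * Real.pi * s * p : ℝ) : ℂ) * Complex.I) else 0

lemma cA_supp (L p s : ℝ) (h : cA L p s ≠ 0) : ∃ k : ℤ, s = p + L * k := by
  by_contra h0; exact h (by simp only [cA]; rw [if_neg h0])

lemma cB_supp (L p s : ℝ) (h : cB L p s ≠ 0) : ∃ k : ℤ, s = 0 + L⁻¹ * k := by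
  by_contra h0; exact h (by simp only [cB]; rw [if_neg h0])

lemma cA_TB (L p : ℝ) (hL : 0 < L) : TB (cA L p) := by
  refine TB_comb _ p L 1 hL (fun s => ?_) (cA_supp L p)
  unfold cA; split_ifs <;> simp

lemma cB_TB (L p : ℝ) (hL : 0 < L) : TB (cB L p) := by
  refine TB_comb _ 0 L⁻¹ (1 / L) (inv_pos.2 hL) (fun s => ?_) (cB_supp L p)
  unfold cB; split_ifs
  · rw [norm_mul, Complex.norm_exp_ofReal_mul_I, mul_one, Complex.norm_real, Real.norm_eq_abs,
      abs_of_pos (by positivity)]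
  · simp; positivity

lemma hx_lattice_tsum (w : ℝ → ℂ) (p h : ℝ) (hh : 0 < h)
    (hw : ∀ s, w s ≠ 0 → ∃ k : ℤ, s = p + h * k) (g : ℝ → ℂ) :
    ∑' s, w s * g s = ∑' k : ℤ, w (p + h * k) * g (p + h * k) := by
  have hinj : Function.Injective (fun k : ℤ => p + h * k) := by
    intro a b hab
    have := mul_left_cancel₀ hh.ne' (add_left_cancel hab)
    exact_mod_cast this
  refine (hinj.tsum_eq (f := fun s => w s * g s) ?_).symm
  intro s hs
  obtain ⟨k, hk⟩ := hw s (left_ne_zero_of_mul hs)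
  exact ⟨k, hk.symm⟩

lemma cA_cB (L p : ℝ) (hL : 0 < L) (f : SchwartzMap ℝ ℂ) :
    ∑' s, cA L p s * SchwartzMap.fourierTransformCLM ℂ f s = ∑' s, cB L p s * f s := by
  rw [hx_lattice_tsum _ p L hL (cA_supp L p), hx_lattice_tsum _ 0 L⁻¹ (inv_pos.2 hL) (cB_supp L p)]
  have h1 : ∀ k : ℤ, cA L p (p + L * k) = 1 := fun k => if_pos ⟨k, rfl⟩
  have h2 : ∀ k : ℤ, cB L p (0 + L⁻¹ * k) * f (0 + L⁻¹ * k) = ((1 / L : ℝ) : ℂ) *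
        Complex.exp (((-2 * Real.pi * (k / L) * p : ℝ) : ℂ) * Complex.I) * f (k / L) := by
    intro k
    have e : (0 : ℝ) + L⁻¹ * k = k / L := by rw [zero_add, inv_mul_eq_div]
    have : cB L p (0 + L⁻¹ * k) = _ := if_pos ⟨k, rfl⟩
    rw [this, e]
  simp only [h1, h2, one_mul]
  exact hx_poisson f L p hL

lemma cA_neg (L p s : ℝ) : cA L (-p) (-s) = cA L p s := by
  unfold cA
  congr 1
  apply propext
  constructor
  · rintro ⟨k, hk⟩; exact ⟨-k, by push_cast; linarith⟩
  · rintro ⟨k, hk⟩; exact ⟨-k, by push_cast; linarith⟩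

lemma cA_period (L p s : ℝ) : cA L p (s + L) = cA L p s := by
  unfold cA
  congr 1
  apply propext
  constructor
  · rintro ⟨k, hk⟩; exact ⟨k - 1, by push_cast; linarith⟩
  · rintro ⟨k, hk⟩; exact ⟨k + 1, by push_cast; linarith⟩

lemma cA_eq_zero (N : ℕ) (p s : ℝ) (hp : (N : ℝ) < p) (hp2 : p < 2 * N) (hs : |s| ≤ N) :
    cA (4 * N) p s = 0 := by
  by_contra h
  obtain ⟨k, hk⟩ := cA_supp _ _ _ h
  have h1 := abs_le.1 hs
  have hN : (0 : ℝ) < N := by linarith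
  have h2 : (k : ℝ) < 0 := by nlinarith
  have h3 : (-1 : ℝ) < k := by nlinarith
  have h2' : k < 0 := by exact_mod_cast h2
  have h3' : -1 < k := by exact_mod_cast h3
  omega

/-- The building block. -/
lemma exists_D (N : ℕ) (hN : 1 ≤ N) (κ : ℂ) (hκ : κ * κ = 1) :
    ∃ (w v : ℝ → ℂ) (L : ℝ), 0 < L ∧ (∀ s, w (s + L) = w s) ∧ TB w ∧ TB v ∧
      (∀ f : SchwartzMap ℝ ℂ,
        ∑' s, w s * SchwartzMap.fourierTransformCLM ℂ f s = ∑' s, v s * f s) ∧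
      LF w ∧ LF v ∧ (∀ s : ℝ, |s| ≤ N → w s = 0) ∧ (∀ s : ℝ, |s| ≤ N → v s = 0) ∧
      (∀ s, w (-s) = -κ * w s) ∧ ∃ s, w s ≠ 0 := by
  have hN0 : (0 : ℝ) < N := by exact_mod_cast hN
  set L : ℝ := 4 * N with hLdef
  have hL : 0 < L := by positivity
  set m : ℕ := 8 * N ^ 2 + 2 with hm
  let p : Fin m → ℝ := fun i => N + N * ((i + 1 : ℝ) / (m + 1))
  have hpN : ∀ i, (N : ℝ) < p i := by
    intro i
    have : 0 < (N : ℝ) * ((i + 1 : ℝ) / (m + 1)) := by positivity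
    simp only [p]; linarith
  have hp2 : ∀ i, p i < 2 * N := by
    intro i
    have : ((i : ℝ) + 1) / (m + 1) < 1 := by
      rw [div_lt_one (by positivity)]
      have : (i : ℝ) < m := by exact_mod_cast i.2
      linarith
    simp only [p]; nlinarith
  have hpinj : ∀ i j, p i = p j → i = j := by
    intro i j h
    simp only [p] at h
    have h1 := mul_left_cancel₀ hN0.ne' (add_left_cancel h)
    rw [div_left_inj' (by positivity)] at h1
    have : ((i : ℕ) : ℝ) = ((j : ℕ) : ℝ) := by linarith
    exact Fin.ext (by exact_mod_cast this)
  -- the linear conditions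
  let kk : Fin (8 * N ^ 2 + 1) → ℤ := fun r => (r : ℤ) - 4 * N ^ 2
  let M : Matrix (Fin (8 * N ^ 2 + 1)) (Fin m) ℂ := fun r i =>
    cB L (p i) (0 + L⁻¹ * (kk r)) - κ * cB L (-p i) (0 + L⁻¹ * (kk r))
  obtain ⟨c, hcM, hc0⟩ : ∃ c : Fin m → ℂ, M.mulVec c = 0 ∧ c ≠ 0 := by
    have := LinearMap.ker_ne_bot_of_finrank_lt (f := M.mulVecLin) (by simp [hm])
    obtain ⟨c, hc, hc0⟩ := (Submodule.ne_bot_iff _).1 this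
    exact ⟨c, by simpa using hc, hc0⟩
  refine ⟨fun s => ∑ i, c i * (cA L (p i) s + (-κ) * cA L (-p i) s),
    fun s => ∑ i, c i * (cB L (p i) s + (-κ) * cB L (-p i) s), L, hL, ?_, ?_, ?_, ?_, ?_, ?_,
    ?_, ?_, ?_, ?_⟩
  · intro s; simp only [cA_period]
  · exact TB.sum _ _ fun i _ => ((cA_TB L _ hL).add ((cA_TB L _ hL).mul _)).mul _
  · exact TB.sum _ _ fun i _ => ((cB_TB L _ hL).add ((cB_TB L _ hL).mul _)).mul _
  · intro f
    set g := SchwartzMap.fourierTransformCLM ℂ f with hg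
    have aux : ∀ (a : ℝ → ℝ → ℂ) (h : SchwartzMap ℝ ℂ) (_ : ∀ q, TB (a q)),
        ∑' s, (∑ i, c i * (a (p i) s + (-κ) * a (-p i) s)) * h s =
          ∑ i, c i * (∑' s, a (p i) s * h s + (-κ) * ∑' s, a (-p i) s * h s) := by
      intro a h ha
      have h1 : ∀ s, (∑ i, c i * (a (p i) s + (-κ) * a (-p i) s)) * h s =
          ∑ i, (c i * (a (p i) s * h s + (-κ) * (a (-p i) s * h s))) := by
        intro s; rw [Finset.sum_mul]; refine Finset.sum_congr rfl fun i _ => by ring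
      simp only [h1]
      rw [Summable.tsum_finsetSum]
      · refine Finset.sum_congr rfl fun i _ => ?_
        rw [tsum_mul_left, Summable.tsum_add ((ha _).summable_mul h)
          (((ha _).summable_mul h).mul_left _), tsum_mul_left]
      · intro i _
        exact (((ha _).summable_mul h).add (((ha _).summable_mul h).mul_left _)).mul_left _
    rw [aux (cA L) g (fun q => cA_TB L q hL), aux (cB L) f (fun q => cB_TB L q hL)]
    simp only [hg, cA_cB L _ hL f]
  · exact LF.sum _ _ fun i _ => ((LF_comb _ _ L hL (cA_supp L _)).add
      ((LF_comb _ _ L hL (cA_supp L _)).mul (fun _ => -κ))).mul (fun _ => c i)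
  · exact LF.sum _ _ fun i _ => ((LF_comb _ _ _ (inv_pos.2 hL) (cB_supp L _)).add
      ((LF_comb _ _ _ (inv_pos.2 hL) (cB_supp L _)).mul (fun _ => -κ))).mul (fun _ => c i)
  · intro s hs
    refine Finset.sum_eq_zero fun i _ => ?_
    have h2 : cA L (-p i) s = 0 := by
      rw [← neg_neg s, cA_neg]
      exact cA_eq_zero N _ _ (hpN i) (hp2 i) (by rwa [abs_neg])
    rw [cA_eq_zero N _ _ (hpN i) (hp2 i) hs, h2]; simp
  · intro s hs
    by_cases h : ∃ k : ℤ, s = 0 + L⁻¹ * k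
    · obtain ⟨k, hk⟩ := h
      have hk2 : |(k : ℝ)| ≤ 4 * N ^ 2 := by
        have : (k : ℝ) = L * s := by rw [hk]; field_simp; ring
        rw [this, abs_mul, abs_of_pos hL]
        nlinarith
      have hk3 := abs_le.1 hk2
      have hk4 : -(4 * (N : ℤ) ^ 2) ≤ k := by exact_mod_cast hk3.1
      have hk5 : k ≤ 4 * (N : ℤ) ^ 2 := by exact_mod_cast hk3.2
      let r : Fin (8 * N ^ 2 + 1) := ⟨(k + 4 * N ^ 2).toNat, by zify; omega⟩
      have hr : kk r = k := by simp only [kk, r]; omega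
      have := congrFun hcM r
      simp only [Matrix.mulVec, dotProduct, Pi.zero_apply, M, hr, ← hk] at this
      rw [← this]
      refine Finset.sum_congr rfl fun i _ => by ring
    · refine Finset.sum_eq_zero fun i _ => ?_
      have h2 : ∀ q, cB L q s = 0 := fun q => if_neg h
      simp [h2]
  · intro s
    rw [Finset.mul_sum]
    refine Finset.sum_congr rfl fun i _ => ?_
    have h1 : cA L (p i) (-s) = cA L (-p i) s := by rw [← cA_neg, neg_neg]
    rw [h1, cA_neg]
    linear_combination (-(c i) * cA L (-p i) s) * hκ
  · obtain ⟨j, hj⟩ := Function.ne_iff.1 hc0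
    refine ⟨p j, ?_⟩
    have h1 : ∀ i, cA L (-p i) (p j) = 0 := by
      intro i
      by_contra h
      obtain ⟨k, hk⟩ := cA_supp _ _ _ h
      have h2 : (0 : ℝ) < k := by nlinarith [hpN i, hpN j, hp2 i, hp2 j]
      have h3 : (k : ℝ) < 1 := by nlinarith [hpN i, hpN j, hp2 i, hp2 j]
      have h2' : 0 < k := by exact_mod_cast h2
      have h3' : k < 1 := by exact_mod_cast h3
      omega
    have h2 : ∀ i, i ≠ j → cA L (p i) (p j) = 0 := by
      intro i hij
      by_contra h
      obtain ⟨k, hk⟩ := cA_supp _ _ _ h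
      have h2 : (-1 : ℝ) < k := by nlinarith [hpN i, hpN j, hp2 i, hp2 j]
      have h3 : (k : ℝ) < 1 := by nlinarith [hpN i, hpN j, hp2 i, hp2 j]
      have h2' : -1 < k := by exact_mod_cast h2
      have h3' : k < 1 := by exact_mod_cast h3
      have : k = 0 := by omega
      rw [this] at hk
      exact hij (hpinj _ _ (by simpa using hk.symm))
    have h3 : cA L (p j) (p j) = 1 := if_pos ⟨0, by simp⟩
    have h4 : ∑ i, c i * (cA L (p i) (p j) + (-κ) * cA L (-p i) (p j)) = c j := by
      rw [Finset.sum_eq_single j]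
      · rw [h3, h1]; simp
      · intro i _ hij; rw [h2 i hij, h1]; simp
      · simp
    show ∑ i, c i * (cA L (p i) (p j) + (-κ) * cA L (-p i) (p j)) ≠ 0
    rw [h4]
    exact hj

end Helpers3

section Helpers4

lemma hx_nonvan (w : ℝ → ℂ) (L R : ℝ) (N : ℕ) (hL : 0 < L) (hper : ∀ s, w (s + L) = w s)
    (hLF : LF w) (hgap : ∀ s : ℝ, |s| ≤ N → w s = 0) (hw0 : ∃ s, w s ≠ 0)
    (φ : ℝ → ℂ) (hφ : ∀ t, φ t ≠ 0 → |t| ≤ R) (hRN : R ≤ N) (hφ0 : ∃ t, φ t ≠ 0) :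
    ∃ x0 : ℝ, ∑' s, w s * φ (x0 - s) ≠ 0 := by
  have hperN : ∀ (n : ℕ) (s : ℝ), w (s + n * L) = w s := by
    intro n
    induction n with
    | zero => intro s; simp
    | succ k ih => intro s; rw [← ih s, ← hper (s + k * L)]; congr 1; push_cast; ring
  obtain ⟨s', hs'⟩ := hw0
  obtain ⟨n, hn⟩ := exists_nat_gt ((-s') / L)
  rw [div_lt_iff₀ hL] at hn
  obtain ⟨s1, hs1pos, hs1⟩ : ∃ s1, 0 < s1 ∧ w s1 ≠ 0 :=
    ⟨s' + n * L, by linarith, by rwa [hperN]⟩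
  have hfin1 : {u : ℝ | 0 < u ∧ u ≤ s1 ∧ w u ≠ 0}.Finite :=
    (hLF s1).subset fun u hu => ⟨by rw [abs_of_pos hu.1]; exact hu.2.1, hu.2.2⟩
  obtain ⟨s0, ⟨hs0pos, hs0le, hs0⟩, hs0min⟩ :=
    Set.exists_min_image _ id hfin1 ⟨s1, hs1pos, le_rfl, hs1⟩
  have hfirst : ∀ u, 0 < u → w u ≠ 0 → s0 ≤ u := by
    intro u hu hwu
    rcases le_total u s1 with h | h
    · exact hs0min u ⟨hu, h, hwu⟩
    · exact hs0le.trans h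
  obtain ⟨δ, hδ, hnext⟩ : ∃ δ > 0, ∀ u, s0 < u → w u ≠ 0 → s0 + δ ≤ u := by
    have hfin2 : {u : ℝ | s0 < u ∧ u ≤ s0 + 1 ∧ w u ≠ 0}.Finite :=
      (hLF (s0 + 1)).subset fun u hu =>
        ⟨by rw [abs_of_pos (hs0pos.trans hu.1)]; exact hu.2.1, hu.2.2⟩
    rcases Set.eq_empty_or_nonempty {u : ℝ | s0 < u ∧ u ≤ s0 + 1 ∧ w u ≠ 0} with h | h
    · refine ⟨1, one_pos, fun u hu hwu => ?_⟩
      by_contra hlt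
      have : u ∈ {u : ℝ | s0 < u ∧ u ≤ s0 + 1 ∧ w u ≠ 0} := ⟨hu, by linarith, hwu⟩
      rw [h] at this
      exact this
    · obtain ⟨u1, ⟨h1, h2, h3⟩, hmin⟩ := Set.exists_min_image _ id hfin2 h
      refine ⟨u1 - s0, by linarith, fun u hu hwu => ?_⟩
      rcases le_total u (s0 + 1) with h4 | h4
      · have := hmin u ⟨hu, h4, hwu⟩
        simp only [id] at this
        linarith
      · linarith
  have hbdd : BddBelow {t | φ t ≠ 0} := ⟨-R, fun t ht => (abs_le.1 (hφ t ht)).1⟩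
  obtain ⟨t, ht, htlt⟩ := exists_lt_of_csInf_lt (s := {t | φ t ≠ 0}) hφ0
    (show sInf {t | φ t ≠ 0} < sInf {t | φ t ≠ 0} + δ by linarith)
  refine ⟨s0 + t, ?_⟩
  rw [tsum_eq_single s0]
  · rw [add_sub_cancel_left]
    exact mul_ne_zero hs0 ht
  · intro s hs
    by_contra h
    have hws := left_ne_zero_of_mul h
    have hfs := right_ne_zero_of_mul h
    rcases lt_or_gt_of_ne hs with h1 | h1
    · have h2 : s ≤ 0 := by
        by_contra h3
        exact absurd (hfirst s (not_le.1 h3) hws) (not_le.2 h1)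
      have h3 : (N : ℝ) < |s| := by
        by_contra h4; exact hws (hgap s (not_lt.1 h4))
      have h4 : (N : ℝ) < |s0| := by
        by_contra h4; exact hs0 (hgap s0 (not_lt.1 h4))
      rw [abs_of_nonpos h2] at h3
      rw [abs_of_pos hs0pos] at h4
      have h5 := (abs_le.1 (hφ _ hfs)).2
      have h6 := (abs_le.1 (hφ _ ht)).1
      linarith
    · have h2 := hnext s h1 hws
      have h3 := csInf_le hbdd (show s0 + t - s ∈ {t | φ t ≠ 0} from hfs)
      linarith

/-- symmetric difference quotient -/
def dq (e : ℝ) (f : SchwartzMap ℝ ℂ) : SchwartzMap ℝ ℂ :=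
  (1 / (2 * Complex.I * e) : ℂ) • (f.compSubConstCLM ℂ (-e) - f.compSubConstCLM ℂ e)

lemma dq_apply (e : ℝ) (f : SchwartzMap ℝ ℂ) (s : ℝ) :
    dq e f s = (1 / (2 * Complex.I * e) : ℂ) * (f (s + e) - f (s - e)) := by
  simp [dq, SchwartzMap.compSubConstCLM_apply]

lemma dq_fourier (e : ℝ) (f : SchwartzMap ℝ ℂ) (s : ℝ) :
    SchwartzMap.fourierTransformCLM ℂ (dq e f) s =
      ((Real.sin (2 * Real.pi * e * s) / e : ℝ) : ℂ) * SchwartzMap.fourierTransformCLM ℂ f s := by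
  have : SchwartzMap.fourierTransformCLM ℂ (dq e f) s = (1 / (2 * Complex.I * e) : ℂ) *
      (SchwartzMap.fourierTransformCLM ℂ (f.compSubConstCLM ℂ (-e)) s -
       SchwartzMap.fourierTransformCLM ℂ (f.compSubConstCLM ℂ e) s) := by
    rw [dq, map_smul, map_sub]; rfl
  rw [this, hx_fourier_shift, hx_fourier_shift, ← sub_mul, ← mul_assoc]
  congr 1
  push_cast
  rw [Complex.sin]
  have e1 : (-2 * (Real.pi : ℂ) * -(e : ℂ) * s * Complex.I) = 2 * Real.pi * e * s * Complex.I := by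
    ring
  have e2 : (-2 * (Real.pi : ℂ) * (e : ℂ) * s * Complex.I) = -(2 * Real.pi * e * s) * Complex.I := by
    ring
  rw [e1, e2, one_div, mul_inv, mul_inv, Complex.inv_I]
  ring

lemma dq_norm (e : ℝ) (he : 0 < e) (a b : ℂ) (q : ℝ)
    (h : ‖a - b‖ ≤ 2 * e * q) : ‖(1 / (2 * Complex.I * e) : ℂ) * (a - b)‖ ≤ q := by
  rw [norm_mul, norm_div, norm_mul, norm_mul, Complex.norm_I, Complex.norm_real,
    Real.norm_eq_abs, abs_of_pos he]
  simp only [norm_one, Complex.norm_ofNat, mul_one]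
  rw [one_div, inv_mul_le_iff₀ (by positivity)]
  exact h

/-- weight of the Fourier transform of the modulated measure -/
def hW (e : ℝ) (v : ℝ → ℂ) (s : ℝ) : ℂ :=
  (1 / (2 * Complex.I * e) : ℂ) * (v (s + -e) + (-1 : ℂ) * v (s + e))

lemma exists_G (w v : ℝ → ℂ) (hw : TB w) (hv : TB v) (K V : ℝ)
    (hK : ∀ x, ∑' s, ‖w s‖ * ((1 + |x - s|) ^ 2)⁻¹ ≤ K)
    (hV : ∀ x, ∑' s, ‖v s‖ * ((1 + |x - s|) ^ 2)⁻¹ ≤ V)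
    (hF : ∀ f : SchwartzMap ℝ ℂ,
        ∑' s, w s * SchwartzMap.fourierTransformCLM ℂ f s = ∑' s, v s * f s)
    (e : ℝ) (he : 0 < e) (he1 : e ≤ 1) :
    ∃ G : SchwartzMap ℝ ℂ →L[ℂ] ℂ,
      WRep G (fun s => ((Real.sin (2 * Real.pi * e * s) / e : ℝ) : ℂ) * w s) ∧
      (∀ f, ‖G f‖ ≤ 16 * Real.pi * K * qS f) ∧
      WRep (fourierTD G) (hW e v) ∧
      (∀ f, ‖fourierTD G f‖ ≤ 32 * V * qS f) ∧
      (∀ f x, ‖convTD (fourierTD G) f x‖ ≤ 32 * V * qS f) := by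
  have hsin : ∀ s : ℝ, ‖((Real.sin (2 * Real.pi * e * s) / e : ℝ) : ℂ)‖ ≤ 2 * Real.pi * |s| := by
    intro s
    rw [Complex.norm_real, Real.norm_eq_abs, abs_div, abs_of_pos he, div_le_iff₀ he]
    refine Real.abs_sin_le_abs.trans (le_of_eq ?_)
    rw [abs_mul, abs_mul, abs_mul, abs_of_pos he, abs_of_pos Real.pi_pos]
    norm_num; ring
  have hbd : ∀ (f : SchwartzMap ℝ ℂ) (s : ℝ),
      ‖((Real.sin (2 * Real.pi * e * s) / e : ℝ) : ℂ) * w s * f s‖ ≤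
        (‖w s‖ * ((1 + |0 - s|) ^ 2)⁻¹) * (16 * Real.pi * qS f) := by
    intro f s
    rw [norm_mul, norm_mul, zero_sub, abs_neg]
    have h1 := qS_zero f s
    have h2 : |s| * ‖f s‖ ≤ ((1 + |s|) ^ 2)⁻¹ * (8 * qS f) := by
      rw [inv_mul_eq_div, le_div_iff₀ (by positivity)]
      refine le_trans ?_ h1
      have : |s| * ‖f s‖ * (1 + |s|) ^ 2 = |s| * ((1 + |s|) ^ 2 * ‖f s‖) := by ring
      rw [this]
      have : (1 + |s|) ^ 3 * ‖f s‖ = (1 + |s|) * ((1 + |s|) ^ 2 * ‖f s‖) := by ring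
      rw [this]
      gcongr
      linarith
    calc _ ≤ (2 * Real.pi * |s|) * ‖w s‖ * ‖f s‖ := by gcongr; exact hsin s
      _ = 2 * Real.pi * ‖w s‖ * (|s| * ‖f s‖) := by ring
      _ ≤ 2 * Real.pi * ‖w s‖ * (((1 + |s|) ^ 2)⁻¹ * (8 * qS f)) := by gcongr
      _ = _ := by ring
  have hq0 : ∀ f, 0 ≤ qS f := fun f => apply_nonneg qS f
  obtain ⟨G, hG, hGn⟩ := hx_exists_T
    (fun s => ((Real.sin (2 * Real.pi * e * s) / e : ℝ) : ℂ) * w s) (16 * Real.pi * K) (by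
      intro f
      have hs := (hw.summable 0).mul_right (16 * Real.pi * qS f)
      refine ⟨Summable.of_norm_bounded hs (hbd f), ?_⟩
      refine (tsum_of_norm_bounded hs.hasSum (hbd f)).trans ?_
      rw [tsum_mul_right]
      calc _ ≤ K * (16 * Real.pi * qS f) := by
            have := hq0 f
            gcongr
            exact hK 0
        _ = _ := by ring)
  have hFG : ∀ f, fourierTD G f = ∑' s, v s * dq e f s := by
    intro f
    have h1 : fourierTD G f = G (SchwartzMap.fourierTransformCLM ℂ f) := rfl
    rw [h1, ← (hG _).tsum_eq, ← hF]
    congr 1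
    ext s
    rw [dq_fourier]
    ring
  have hbound : ∀ (f : SchwartzMap ℝ ℂ) (x q : ℝ),
      (∀ s, ‖dq e f s‖ ≤ q * ((1 + |x - s|) ^ 2)⁻¹) → 0 ≤ q →
      ‖fourierTD G f‖ ≤ V * q := by
    intro f x q hq hq0
    rw [hFG]
    have hs := (hv.summable x).mul_right q
    refine (tsum_of_norm_bounded hs.hasSum (fun s => ?_)).trans ?_
    · rw [norm_mul, mul_assoc, mul_comm _ q]
      gcongr
      exact hq s
    · rw [tsum_mul_right]
      gcongr
      exact hV x
  refine ⟨G, hG, hGn, ?_, ?_, ?_⟩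
  · intro f
    have hs1 : Summable (fun s => v s * f (s + e)) := by
      have := hv.summable_mul (f.compSubConstCLM ℂ (-e))
      simpa [SchwartzMap.compSubConstCLM_apply] using this
    have hs2 : Summable (fun s => v s * f (s - e)) := by
      have := hv.summable_mul (f.compSubConstCLM ℂ e)
      simpa [SchwartzMap.compSubConstCLM_apply] using this
    have h1 : HasSum (fun s => v (s + -e) * f s) (∑' s, v s * f (s + e)) := by
      have := (Equiv.addRight (-e)).hasSum_iff.2 hs1.hasSum
      simpa [Function.comp_def] using this
    have h2 : HasSum (fun s => v (s + e) * f s) (∑' s, v s * f (s - e)) := by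
      have := (Equiv.addRight e).hasSum_iff.2 hs2.hasSum
      simpa [Function.comp_def] using this
    have h3 := (h1.sub h2).mul_left (1 / (2 * Complex.I * e) : ℂ)
    rw [hFG]
    have e1 : ∑' s, v s * dq e f s = (1 / (2 * Complex.I * e) : ℂ) *
        (∑' s, v s * f (s + e) - ∑' s, v s * f (s - e)) := by
      rw [← hs1.tsum_sub hs2, ← tsum_mul_left]
      congr 1
      ext s
      rw [dq_apply]; ring
    rw [e1]
    refine h3.congr_fun ?_ |> fun h => h
    intro s
    simp only [hW]
    ring
  · intro f
    have := hbound f 0 (32 * qS f) (fun s => ?_) (by have := hq0 f; positivity)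
    · linarith
    · rw [dq_apply, zero_sub, abs_neg]
      exact dq_norm e he _ _ _ (qS_diff f s e he he1)
  · intro f x
    have := hbound (transRefl x f) x (32 * qS f) (fun s => ?_) (by have := hq0 f; positivity)
    · have h2 : convTD (fourierTD G) f x = fourierTD G (transRefl x f) := rfl
      rw [h2]; linarith
    · rw [dq_apply, transRefl_apply, transRefl_apply]
      refine dq_norm e he _ _ _ ?_
      have := qS_diff f (x - s) e he he1
      rw [norm_sub_rev] at this
      have e1 : x - (s + e) = x - s - e := by ring
      have e2 : x - (s - e) = x - s + e := by ring
      rw [e1, e2]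
      exact this

end Helpers4

section Helpers5

lemma WRep.add {S T : SchwartzMap ℝ ℂ →L[ℂ] ℂ} {w v : ℝ → ℂ} (hS : WRep S w) (hT : WRep T v) :
    WRep (S + T) (fun s => w s + v s) := by
  intro f
  have := (hS f).add (hT f)
  simpa [add_mul] using this

lemma WRep.smul {S : SchwartzMap ℝ ℂ →L[ℂ] ℂ} {w : ℝ → ℂ} (hS : WRep S w) (c : ℂ) :
    WRep (c • S) (fun s => c * w s) := by
  intro f
  have := (hS f).mul_left c
  simpa [mul_assoc] using this

lemma hx_large (w : ℝ → ℂ) (L R x0 : ℝ) (hL : 0 < L) (hper : ∀ s, w (s + L) = w s)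
    (hLF : LF w) (φ : ℝ → ℂ) (hφ : ∀ t, φ t ≠ 0 → |t| ≤ R)
    (hx0 : ∑' s, w s * φ (x0 - s) ≠ 0) (A : ℝ) :
    ∃ e : ℝ, 0 < e ∧ e ≤ 1 ∧ ∃ x : ℝ,
      A ≤ ‖∑' s, ((Real.sin (2 * Real.pi * e * s) / e : ℝ) : ℂ) * w s * φ (x - s)‖ := by
  have hperN : ∀ (n : ℕ) (s : ℝ), w (s + n * L) = w s := by
    intro n
    induction n with
    | zero => intro s; simp
    | succ k ih => intro s; rw [← ih s, ← hper (s + k * L)]; congr 1; push_cast; ring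
  have hfin := hLF (|x0| + R)
  set Fs := hfin.toFinset with hFs
  have hoff : ∀ s ∉ Fs, w s * φ (x0 - s) = 0 := by
    intro s hs
    by_contra h
    apply hs
    rw [hFs, Set.Finite.mem_toFinset]
    refine ⟨?_, left_ne_zero_of_mul h⟩
    have h1 := hφ _ (right_ne_zero_of_mul h)
    have h2 : |s| ≤ |x0| + |x0 - s| := by
      have := abs_sub x0 (x0 - s)
      simpa using this
    linarith
  rw [tsum_eq_sum hoff] at hx0
  have hval : ∀ q : ℕ, 0 < q →
      ∑' s, ((Real.sin (2 * Real.pi * (1 / (4 * L * q)) * s) / (1 / (4 * L * q)) : ℝ) : ℂ) * w s *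
        φ (x0 + q * L - s) =
      ((4 * L * q : ℝ) : ℂ) * ∑ s ∈ Fs, ((Real.cos (2 * Real.pi * s / (4 * L * q)) : ℝ) : ℂ) *
        (w s * φ (x0 - s)) := by
    intro q hq
    have hq' : (0 : ℝ) < q := by exact_mod_cast hq
    rw [← (Equiv.addRight (q * L)).tsum_eq]
    have e1 : ∀ s : ℝ, ((Real.sin (2 * Real.pi * (1 / (4 * L * q)) * ((Equiv.addRight (q * L)) s)) /
        (1 / (4 * L * q)) : ℝ) : ℂ) * w ((Equiv.addRight (q * L)) s) *
        φ (x0 + q * L - (Equiv.addRight (q * L)) s) =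
        ((4 * L * q : ℝ) : ℂ) * (((Real.cos (2 * Real.pi * s / (4 * L * q)) : ℝ) : ℂ) *
        (w s * φ (x0 - s))) := by
      intro s
      simp only [Equiv.coe_addRight]
      have a1 : 2 * Real.pi * (1 / (4 * L * q)) * (s + q * L) =
          2 * Real.pi * s / (4 * L * q) + Real.pi / 2 := by
        field_simp; ring
      have a2 : x0 + q * L - (s + q * L) = x0 - s := by ring
      rw [a1, a2, Real.sin_add_pi_div_two, hperN, div_div_eq_mul_div, div_one]
      push_cast
      ring
    simp only [e1]
    rw [tsum_mul_left, tsum_eq_sum]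
    intro s hs
    rw [hoff s hs, mul_zero]
  have hlim : Tendsto (fun q : ℕ => ‖∑ s ∈ Fs,
      ((Real.cos (2 * Real.pi * s / (4 * L * q)) : ℝ) : ℂ) * (w s * φ (x0 - s))‖) atTop
      (𝓝 ‖∑ s ∈ Fs, w s * φ (x0 - s)‖) := by
    refine Tendsto.norm (tendsto_finsetSum _ fun s _ => ?_)
    have h1 : Tendsto (fun q : ℕ => 2 * Real.pi * s / (4 * L * q)) atTop (𝓝 0) := by
      refine Tendsto.const_div_atTop ?_ _
      exact tendsto_natCast_atTop_atTop.const_mul_atTop (by positivity)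
    have h2 := (Real.continuous_cos.tendsto 0).comp h1
    have h3 := ((Complex.continuous_ofReal.tendsto _).comp h2).mul_const (w s * φ (x0 - s))
    simpa using h3
  have hlim2 : Tendsto (fun q : ℕ => (4 * L * q) * ‖∑ s ∈ Fs,
      ((Real.cos (2 * Real.pi * s / (4 * L * q)) : ℝ) : ℂ) * (w s * φ (x0 - s))‖) atTop atTop :=
    Tendsto.atTop_mul_pos (norm_pos_iff.2 hx0)
      (tendsto_natCast_atTop_atTop.const_mul_atTop (by positivity)) hlim
  have hev3 : ∀ᶠ q : ℕ in atTop, (1 : ℝ) ≤ 4 * L * q :=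
    (tendsto_natCast_atTop_atTop.const_mul_atTop (by positivity : 0 < 4 * L)).eventually_ge_atTop 1
  obtain ⟨q, hq1, hq2, hq3⟩ := ((hlim2.eventually_ge_atTop A).and
    ((eventually_gt_atTop 0).and hev3)).exists
  have hq' : (0 : ℝ) < q := by exact_mod_cast hq2
  refine ⟨1 / (4 * L * q), by positivity, ?_, x0 + q * L, ?_⟩
  · rw [div_le_one (by positivity)]; exact hq3
  · rw [hval q hq2, norm_mul, Complex.norm_real, Real.norm_eq_abs,
      abs_of_pos (by positivity : 0 < 4 * L * q)]
    exact hq1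

lemma hx_supp (φ : SchwartzMap ℝ ℂ) (hφc : IsTestFn φ) :
    ∃ R : ℝ, ∀ t, φ t ≠ 0 → |t| ≤ R := by
  obtain ⟨R, hR⟩ := hφc.isCompact.isBounded.subset_closedBall 0
  refine ⟨R, fun t ht => ?_⟩
  have := hR (subset_tsupport _ ht)
  simpa using this

lemma exists_E (lam : ℂ) (hlam : lam ^ 4 = 1) (hlam1 : ‖lam‖ = 1)
    (φ : SchwartzMap ℝ ℂ) (hφc : IsTestFn φ) (hφ0 : φ ≠ 0) (n : ℕ) :
    ∃ (E : SchwartzMap ℝ ℂ →L[ℂ] ℂ) (u : ℝ → ℂ), WRep E u ∧ LF u ∧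
      (∀ s : ℝ, |s| ≤ n → u s = 0) ∧ fourierTD E = lam • E ∧ (∀ f, ‖E f‖ ≤ qS f) ∧
      ∃ x, (n : ℝ) ≤ ‖convTD E φ x‖ := by
  have hl0 : lam ≠ 0 := by rintro rfl; simp at hlam1
  obtain ⟨R, hR⟩ := hx_supp φ hφc
  obtain ⟨t0, ht0⟩ : ∃ t, φ t ≠ 0 := by
    by_contra h
    push Not at h
    exact hφ0 (by ext t; simpa using h t)
  set N : ℕ := n + 1 + ⌈R⌉₊ with hN
  have hRN : R ≤ N := by
    refine (Nat.le_ceil R).trans ?_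
    exact_mod_cast (by omega : ⌈R⌉₊ ≤ N)
  have hnN : (n : ℝ) + 1 ≤ N := by exact_mod_cast (by omega : n + 1 ≤ N)
  obtain ⟨w, v, L, hL, hper, hw, hv, hF, hwLF, hvLF, hwg, hvg, hpar, hw0⟩ :=
    exists_D N (by omega) (lam ^ 2) (by rw [← hlam]; ring)
  obtain ⟨K, hK0, hK⟩ := hw.tsum_le
  obtain ⟨V, hV0, hV⟩ := hv.tsum_le
  obtain ⟨x0, hx0⟩ := hx_nonvan w L R N hL hper hwLF hwg hw0 φ hR hRN ⟨t0, ht0⟩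
  set C : ℝ := 16 * Real.pi * K + 32 * V + 1 with hC
  have hCpos : 0 < C := by positivity
  obtain ⟨e, he, he1, x, hx⟩ := hx_large w L R x0 hL hper hwLF φ hR hx0 (n * C + 32 * V * qS φ)
  obtain ⟨G, hG, hGn, hH, hHn, hHc⟩ := exists_G w v hw hv K V hK hV hF e he he1
  set g : ℝ → ℂ := fun s => ((Real.sin (2 * Real.pi * e * s) / e : ℝ) : ℂ) * w s with hg
  have hgpar : ∀ s, g (-s) = lam ^ 2 * g s := by
    intro s
    simp only [hg]
    rw [hpar, mul_neg, Real.sin_neg]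
    push_cast
    ring
  have hconvG : convTD G φ x = ∑' s, g s * φ (x - s) := (hG (transRefl x φ)).tsum_eq.symm
  have hFF : ∀ f, fourierTD (fourierTD G) f = lam ^ 2 * G f := by
    intro f
    have h1 : fourierTD (fourierTD G) f =
      G (SchwartzMap.fourierTransformCLM ℂ (SchwartzMap.fourierTransformCLM ℂ f)) := rfl
    rw [h1]
    have h2 := hG (SchwartzMap.fourierTransformCLM ℂ (SchwartzMap.fourierTransformCLM ℂ f))
    have h3 := (Equiv.neg ℝ).hasSum_iff.2 h2
    refine h3.unique ?_
    have h4 := (hG f).mul_left (lam ^ 2)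
    have hfun : ((fun s => g s * (SchwartzMap.fourierTransformCLM ℂ (SchwartzMap.fourierTransformCLM ℂ f)) s) ∘ (Equiv.neg ℝ))
        = fun s => lam ^ 2 * (g s * f s) := by
      funext s
      simp only [Function.comp_apply, Equiv.neg_apply, hx_fourier_fourier, neg_neg]
      rw [hgpar s]; ring
    rw [← hfun] at h4
    exact h4
  have hCc : ‖((1 / C : ℝ) : ℂ)‖ = 1 / C := by
    rw [Complex.norm_real, Real.norm_eq_abs, abs_of_pos (by positivity)]
  refine ⟨((1 / C : ℝ) : ℂ) • (G + lam⁻¹ • fourierTD G),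
    fun s => ((1 / C : ℝ) : ℂ) * (g s + lam⁻¹ * hW e v s),
    (hG.add (hH.smul _)).smul _, ?_, ?_, ?_, ?_, x, ?_⟩
  · refine LF.mul (LF.add (hwLF.mul _) (LF.mul ?_ (fun _ => lam⁻¹))) (fun _ => ((1 / C : ℝ) : ℂ))
    exact LF.mul ((hvLF.shift (-e)).add ((hvLF.shift e).mul (fun _ => (-1 : ℂ))))
      (fun _ => (1 / (2 * Complex.I * e) : ℂ))
  · intro s hs
    have h1 : w s = 0 := hwg s (by linarith)
    have hee : |e| ≤ 1 := by rw [abs_of_pos he]; exact he1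
    have h2 : v (s + e) = 0 := hvg _ ((abs_add_le _ _).trans (by linarith))
    have h3 : v (s + -e) = 0 := hvg _ ((abs_add_le _ _).trans (by rw [abs_neg]; linarith))
    simp only [hg, hW, h1, h2, h3]
    simp
  · ext f
    have h1 : fourierTD (((1 / C : ℝ) : ℂ) • (G + lam⁻¹ • fourierTD G)) f =
      ((1 / C : ℝ) : ℂ) * (fourierTD G f + lam⁻¹ * fourierTD (fourierTD G) f) := rfl
    have h2 : (lam • ((1 / C : ℝ) : ℂ) • (G + lam⁻¹ • fourierTD G)) f =
      lam * (((1 / C : ℝ) : ℂ) * (G f + lam⁻¹ * fourierTD G f)) := rfl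
    rw [h1, h2, hFF]
    field_simp
    ring
  · intro f
    have h1 : (((1 / C : ℝ) : ℂ) • (G + lam⁻¹ • fourierTD G)) f =
      ((1 / C : ℝ) : ℂ) * (G f + lam⁻¹ * fourierTD G f) := rfl
    rw [h1, norm_mul, hCc, one_div, inv_mul_le_iff₀ hCpos]
    refine (norm_add_le _ _).trans ?_
    rw [norm_mul, norm_inv, hlam1, inv_one, one_mul]
    have := hGn f
    have := hHn f
    have := apply_nonneg qS f
    rw [hC]
    linarith
  · have h1 : convTD (((1 / C : ℝ) : ℂ) • (G + lam⁻¹ • fourierTD G)) φ x =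
      ((1 / C : ℝ) : ℂ) * (convTD G φ x + lam⁻¹ * convTD (fourierTD G) φ x) := rfl
    rw [h1, norm_mul, hCc, one_div, le_inv_mul_iff₀ hCpos]
    have h2 : ‖lam⁻¹ * convTD (fourierTD G) φ x‖ ≤ 32 * V * qS φ := by
      rw [norm_mul, norm_inv, hlam1, inv_one, one_mul]; exact hHc φ x
    have h3 := norm_sub_le (convTD G φ x + lam⁻¹ * convTD (fourierTD G) φ x)
      (lam⁻¹ * convTD (fourierTD G) φ x)
    rw [add_sub_cancel_right] at h3
    rw [← hconvG] at hx
    linarith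

end Helpers5

section Helpers6

lemma hx_cutoff (g : SchwartzMap ℝ ℂ) : ∃ h : ℕ → SchwartzMap ℝ ℂ, (∀ N, IsTestFn (h N)) ∧
    (∀ N x, ‖h N x‖ ≤ ‖g x‖) ∧ Tendsto (fun N => qS (h N - g)) atTop (𝓝 0) := by
  let χ : ContDiffBump (0 : ℝ) := ⟨1, 2, by norm_num, by norm_num⟩
  have hχs : ContDiff ℝ (⊤ : ℕ∞) χ := χ.contDiff
  have hχd : Differentiable ℝ χ := hχs.differentiable (by simp)
  obtain ⟨B, hB⟩ : ∃ B, ∀ x, ‖deriv χ x‖ ≤ B := by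
    have hc : Continuous (deriv χ) := hχs.continuous_deriv (by simp)
    exact hc.bounded_above_of_compact_support χ.hasCompactSupport.deriv
  have hB0 : 0 ≤ B := (norm_nonneg _).trans (hB 0)
  have hpos : ∀ N : ℕ, (0 : ℝ) < N + 1 := fun N => by positivity
  let c : ℕ → ℝ → ℂ := fun N x => ((χ (x / (N + 1)) : ℝ) : ℂ)
  have hcs : ∀ N, ContDiff ℝ (⊤ : ℕ∞) (c N) := fun N =>
    Complex.ofRealCLM.contDiff.comp (hχs.comp (contDiff_id.div_const _))
  have hcc : ∀ N, HasCompactSupport (c N) := by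
    intro N
    refine HasCompactSupport.of_support_subset_isCompact (isCompact_closedBall (0 : ℝ) (2 * (N + 1))) ?_
    intro x hx
    rw [mem_closedBall_zero_iff, Real.norm_eq_abs]
    by_contra hlt
    push Not at hlt
    apply hx
    have : χ (x / (N + 1)) = 0 := by
      apply χ.zero_of_le_dist
      rw [dist_zero_right, Real.norm_eq_abs, abs_div, abs_of_pos (hpos N), le_div_iff₀ (hpos N)]
      exact hlt.le
    simp [c, this]
  have hcd : ∀ N x, HasDerivAt (c N) (((deriv χ (x / (N + 1)) * (1 / (N + 1)) : ℝ)) : ℂ) x := by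
    intro N x
    have h1 : HasDerivAt (fun x : ℝ => x / ((N : ℝ) + 1)) (1 / (N + 1)) x :=
      (hasDerivAt_id x).div_const _
    have h2 := (hχd (x / (N + 1))).hasDerivAt.comp x h1
    exact h2.ofReal_comp
  have hgs : ContDiff ℝ (⊤ : ℕ∞) g := g.smooth _
  let h : ℕ → SchwartzMap ℝ ℂ := fun N =>
    HasCompactSupport.toSchwartzMap (f := fun x => c N x * g x) ((hcc N).mul_right) ((hcs N).mul hgs)
  have hh : ∀ N x, h N x = c N x * g x := fun N x => rfl
  have hc1 : ∀ N x, ‖c N x‖ ≤ 1 := by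
    intro N x
    simp only [c]
    rw [Complex.norm_real, Real.norm_eq_abs, abs_of_nonneg χ.nonneg]
    exact χ.le_one
  have hcm : ∀ N x, ‖c N x - 1‖ * (N + 1) ≤ |x| := by
    intro N x
    rcases le_or_gt |x| (N + 1) with hx | hx
    · have : χ (x / (N + 1)) = 1 := by
        apply χ.one_of_mem_closedBall
        rw [mem_closedBall_zero_iff, Real.norm_eq_abs, abs_div, abs_of_pos (hpos N),
          div_le_iff₀ (hpos N)]
        simpa [χ] using hx
      simp [c, this]
    · have : ‖c N x - 1‖ ≤ 1 := by
        have : c N x - 1 = ((χ (x / (N + 1)) - 1 : ℝ) : ℂ) := by simp [c]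
        rw [this, Complex.norm_real, Real.norm_eq_abs, abs_le]
        have h1 := χ.nonneg (x := x / (N + 1))
        have h2 := χ.le_one (x := x / (N + 1))
        constructor <;> linarith
      have := mul_le_mul_of_nonneg_right this (hpos N).le
      linarith
  have hcd1 : ∀ (N : ℕ) (x : ℝ), ‖(((deriv χ (x / (N + 1)) * (1 / (N + 1)) : ℝ)) : ℂ)‖ * (N + 1) ≤ B := by
    intro N x
    rw [Complex.norm_real, norm_mul, Real.norm_eq_abs (1 / _), abs_of_pos (one_div_pos.2 (hpos N))]
    have := hpos N
    have h3 := hB (x / (N + 1))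
    field_simp
    exact h3
  refine ⟨h, fun N => (hcc N).mul_right, fun N x => ?_, ?_⟩
  · rw [hh, norm_mul]
    exact mul_le_of_le_one_left (norm_nonneg _) (hc1 N x)
  have hb0 : ∀ k N, SchwartzMap.seminorm ℂ k 0 (h N - g) ≤
      SchwartzMap.seminorm ℂ (k + 1) 0 g / (N + 1) := by
    intro k N
    refine SchwartzMap.seminorm_le_bound ℂ k 0 _ (by have := hpos N; positivity) fun x => ?_
    rw [norm_iteratedFDeriv_zero, le_div_iff₀ (hpos N)]
    have e1 := SchwartzMap.le_seminorm ℂ (k + 1) 0 g x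
    rw [norm_iteratedFDeriv_zero] at e1
    refine le_trans ?_ e1
    have e2 : (h N - g) x = (c N x - 1) * g x := by
      rw [SchwartzMap.sub_apply, hh]; ring
    rw [e2, norm_mul, pow_succ, Real.norm_eq_abs]
    calc |x| ^ k * (‖c N x - 1‖ * ‖g x‖) * (N + 1)
        = (|x| ^ k * ‖g x‖) * (‖c N x - 1‖ * (N + 1)) := by ring
      _ ≤ (|x| ^ k * ‖g x‖) * |x| := by gcongr; exact hcm N x
      _ = _ := by ring
  have hb1 : ∀ k N, SchwartzMap.seminorm ℂ k 1 (h N - g) ≤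
      (SchwartzMap.seminorm ℂ (k + 1) 1 g + B * SchwartzMap.seminorm ℂ k 0 g) / (N + 1) := by
    intro k N
    refine SchwartzMap.seminorm_le_bound' ℂ k 1 _ (by have := hpos N; positivity) fun x => ?_
    rw [iteratedDeriv_one, le_div_iff₀ (hpos N)]
    have e1 := SchwartzMap.le_seminorm' ℂ (k + 1) 1 g x
    rw [iteratedDeriv_one] at e1
    have e0 := SchwartzMap.le_seminorm' ℂ k 0 g x
    rw [iteratedDeriv_zero] at e0
    have e2 : deriv (h N - g) x = (((deriv χ (x / (N + 1)) * (1 / (N + 1)) : ℝ)) : ℂ) * g x +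
        (c N x - 1) * deriv g x := by
      have hg := (g.differentiableAt (x := x)).hasDerivAt
      have := ((hcd N x).mul hg).sub hg
      have h3 : HasDerivAt (h N - g : SchwartzMap ℝ ℂ) _ x := this
      rw [h3.deriv]; ring
    rw [e2]
    calc |x| ^ k * ‖(((deriv χ (x / (N + 1)) * (1 / (N + 1)) : ℝ)) : ℂ) * g x +
        (c N x - 1) * deriv g x‖ * (N + 1)
        ≤ |x| ^ k * (‖(((deriv χ (x / (N + 1)) * (1 / (N + 1)) : ℝ)) : ℂ)‖ * ‖g x‖ +
        ‖c N x - 1‖ * ‖deriv g x‖) * (N + 1) := by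
          have := hpos N
          gcongr
          refine (norm_add_le _ _).trans ?_
          rw [norm_mul, norm_mul]
      _ = (|x| ^ k * ‖deriv g x‖) * (‖c N x - 1‖ * (N + 1)) + 
          (|x| ^ k * ‖g x‖) * (‖(((deriv χ (x / (N + 1)) * (1 / (N + 1)) : ℝ)) : ℂ)‖ * (N + 1)) := by ring
      _ ≤ (|x| ^ k * ‖deriv g x‖) * |x| + (|x| ^ k * ‖g x‖) * B := by
          gcongr
          · exact hcm N x
          · exact hcd1 N x
      _ ≤ _ := by
          rw [pow_succ] at e1
          nlinarith
  have hlim : ∀ M : ℝ, Tendsto (fun N : ℕ => M / ((N : ℝ) + 1)) atTop (𝓝 0) := fun M => by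
    have := tendsto_one_div_add_atTop_nhds_zero_nat (𝕜 := ℝ)
    simpa [div_eq_mul_inv] using this.const_mul M
  have hM : ∃ M : ℝ, ∀ N, qS (h N - g) ≤ M / (N + 1) := by
    let M : ℝ := ∑ k ∈ Finset.range 4, (SchwartzMap.seminorm ℂ (k + 1) 0 g +
      (SchwartzMap.seminorm ℂ (k + 1) 1 g + B * SchwartzMap.seminorm ℂ k 0 g))
    refine ⟨M, fun N => ?_⟩
    have hM0 : 0 ≤ M := Finset.sum_nonneg fun k _ => by positivity
    unfold qS
    refine Seminorm.finset_sup_apply_le (by have := hpos N; positivity) ?_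
    rintro ⟨k, l⟩ hkl
    rw [Finset.mem_Iic, Prod.mk_le_mk] at hkl
    have hk : (SchwartzMap.seminorm ℂ (k + 1) 0 g +
      (SchwartzMap.seminorm ℂ (k + 1) 1 g + B * SchwartzMap.seminorm ℂ k 0 g)) ≤ M :=
      Finset.single_le_sum (f := fun k => (SchwartzMap.seminorm ℂ (k + 1) 0 g +
      (SchwartzMap.seminorm ℂ (k + 1) 1 g + B * SchwartzMap.seminorm ℂ k 0 g)))
        (fun k _ => by positivity) (Finset.mem_range.2 (by omega))
    have n1 : 0 ≤ SchwartzMap.seminorm ℂ (k + 1) 0 g := by positivity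
    have n2 : 0 ≤ SchwartzMap.seminorm ℂ (k + 1) 1 g + B * SchwartzMap.seminorm ℂ k 0 g := by positivity
    have hl : l = 0 ∨ l = 1 := by omega
    rcases hl with rfl | rfl
    · refine (hb0 k N).trans ?_
      have := hpos N
      gcongr
      linarith
    · refine (hb1 k N).trans ?_
      have := hpos N
      gcongr
      linarith
  obtain ⟨M, hM⟩ := hM
  exact squeeze_zero (fun N => apply_nonneg _ _) hM (hlim M)

lemma hx_measure (W : ℝ → ℂ) (hW : LF W) : ∃ η : CMeasure ℝ, η.IsPurePoint ∧
    η.LocallyFiniteSupport ∧ ∀ f : SchwartzMap ℝ ℂ, IsTestFn f →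
      HasSum (fun s => W s * f s) (η.pairing f) := by
  classical
  set S : Set ℝ := {s | W s ≠ 0} with hS
  have hSc : S.Countable := by
    have : S = ⋃ n : ℕ, {s : ℝ | |s| ≤ n ∧ W s ≠ 0} := by
      ext s
      simp only [hS, Set.mem_setOf_eq, Set.mem_iUnion]
      constructor
      · intro h
        obtain ⟨n, hn⟩ := exists_nat_ge |s|
        exact ⟨n, hn, h⟩
      · rintro ⟨n, _, h⟩; exact h
    rw [this]
    exact Set.countable_iUnion fun n => (hW n).countable
  let tv : Measure ℝ := Measure.sum (fun s : ℝ => ENNReal.ofReal ‖W s‖ • Measure.dirac s)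
  have hSm : MeasurableSet Sᶜ := hSc.measurableSet.compl
  have htv0 : tv Sᶜ = 0 := by
    rw [Measure.sum_apply _ hSm]
    simp only [ENNReal.tsum_eq_zero]
    intro s
    by_cases h : W s = 0
    · simp [h]
    · have : s ∉ Sᶜ := by simpa [hS] using h
      simp [Measure.dirac_apply' _ hSm, this]
  have hball : ∀ r : ℝ, tv (closedBall 0 r) < ⊤ := by
    intro r
    rw [Measure.sum_apply _ measurableSet_closedBall]
    rw [tsum_eq_sum (s := (hW r).toFinset)]
    · refine ENNReal.sum_lt_top.2 fun s _ => ?_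
      rw [Measure.smul_apply, smul_eq_mul]
      exact ENNReal.mul_lt_top ENNReal.ofReal_lt_top (measure_lt_top _ _)
    · intro s hs
      rw [Measure.smul_apply, smul_eq_mul, Measure.dirac_apply' _ measurableSet_closedBall]
      simp only [Set.Finite.mem_toFinset, Set.mem_setOf_eq, not_and_or, not_not] at hs
      rcases hs with hs | hs
      · have : s ∉ closedBall (0 : ℝ) r := by
          rw [mem_closedBall_zero_iff, Real.norm_eq_abs]; exact hs
        simp [this]
      · simp [hs]
  have hlf : IsLocallyFiniteMeasure tv := by
    refine ⟨fun x => ⟨closedBall 0 (|x| + 1), ?_, hball _⟩⟩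
    refine mem_of_superset (ball_mem_nhds x one_pos) ?_
    intro y hy
    rw [mem_ball, Real.dist_eq] at hy
    rw [mem_closedBall_zero_iff, Real.norm_eq_abs]
    have := abs_add_le (y - x) x
    rw [sub_add_cancel] at this
    linarith
  let d : ℝ → ℂ := fun s => if W s = 0 then 1 else W s / ‖W s‖
  have hd1 : ∀ s, ‖d s‖ = 1 := by
    intro s
    simp only [d]
    split_ifs with h
    · simp
    · rw [norm_div, Complex.norm_real, norm_norm, div_self (norm_ne_zero_iff.2 h)]
  have hdm : Measurable d := by
    refine Measurable.measurable_of_countable_ne (f := fun _ => (1 : ℂ)) measurable_const ?_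
    refine hSc.mono fun s hs => ?_
    simp only [Set.mem_setOf_eq, hS] at hs ⊢
    intro h
    exact hs (by simp [d, h])
  refine ⟨⟨tv, hlf, d, hdm, ae_of_all _ hd1⟩, ⟨S, hSc, htv0⟩, ⟨S, fun K hK => ?_, htv0⟩, fun f hf => ?_⟩
  · obtain ⟨r, hr⟩ := hK.isBounded.subset_closedBall 0
    refine (hW r).subset ?_
    rintro s ⟨h1, h2⟩
    have := hr h2
    rw [mem_closedBall_zero_iff, Real.norm_eq_abs] at this
    exact ⟨this, h1⟩
  · have hi : Integrable (fun x => f x * d x) tv := by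
      have h1 : Integrable f tv := f.continuous.integrable_of_hasCompactSupport hf
      exact h1.mul_bdd (c := 1) hdm.aestronglyMeasurable (ae_of_all _ fun s => (hd1 s).le)
    have h2 := hasSum_integral_measure hi
    refine h2.congr_fun ?_
    intro s
    rw [integral_smul_measure, integral_dirac]
    rw [ENNReal.toReal_ofReal (norm_nonneg _)]
    by_cases h : W s = 0
    · simp [h]
    · have : (‖W s‖ : ℂ) ≠ 0 := by simpa using h
      simp only [d, h, if_false, Complex.real_smul]
      field_simp

lemma hx_tempered_int (μ : Measure ℝ) (C a : ℝ)
    (hμ : ∀ r : ℝ, 1 ≤ r → μ (Metric.closedBall 0 r) ≤ ENNReal.ofReal (C * r ^ a))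
    (g : SchwartzMap ℝ ℂ) : ∫⁻ x, ‖g x‖ₑ ∂μ < ⊤ := by
  set k : ℕ := ⌈a⌉₊ + 2 with hk
  obtain ⟨M, hM0, hM⟩ : ∃ M : ℝ, 0 ≤ M ∧ ∀ x : ℝ, (1 + |x|) ^ k * ‖g x‖ ≤ M := by
    refine ⟨2 ^ k * ((Finset.Iic ((k, 0) : ℕ × ℕ)).sup (fun m => SchwartzMap.seminorm ℂ m.1 m.2)) g,
      by positivity, fun x => ?_⟩
    have := SchwartzMap.one_add_le_sup_seminorm_apply (𝕜 := ℂ) (m := (k, 0)) (k := k) (n := 0)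
      le_rfl le_rfl g x
    rw [norm_iteratedFDeriv_zero, Real.norm_eq_abs] at this
    exact this
  have hpt : ∀ x, ‖g x‖ₑ ≤ ∑' n : ℕ, (closedBall (0 : ℝ) (n + 1)).indicator
      (fun _ => ENNReal.ofReal (M / ((n : ℝ) + 1) ^ k)) x := by
    intro x
    refine le_trans ?_ (ENNReal.le_tsum ⌊|x|⌋₊)
    have hx : x ∈ closedBall (0 : ℝ) (⌊|x|⌋₊ + 1) := by
      rw [mem_closedBall_zero_iff, Real.norm_eq_abs]
      exact (Nat.lt_floor_add_one _).le
    rw [Set.indicator_of_mem hx, ← ofReal_norm_eq_enorm]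
    apply ENNReal.ofReal_le_ofReal
    rw [le_div_iff₀ (by positivity), mul_comm]
    refine le_trans ?_ (hM x)
    have := Nat.floor_le (abs_nonneg x)
    refine mul_le_mul_of_nonneg_right ?_ (norm_nonneg _)
    exact pow_le_pow_left₀ (by positivity) (by linarith) _
  refine (lintegral_mono hpt).trans_lt ?_
  rw [lintegral_tsum (fun n => (measurable_const.indicator measurableSet_closedBall).aemeasurable)]
  have hterm : ∀ n : ℕ, ∫⁻ x, (closedBall (0 : ℝ) (n + 1)).indicator
      (fun _ => ENNReal.ofReal (M / ((n : ℝ) + 1) ^ k)) x ∂μ ≤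
      ENNReal.ofReal (M * |C| * (1 / ((n : ℝ) + 1) ^ 2)) := by
    intro n
    rw [lintegral_indicator_const measurableSet_closedBall]
    have hn : (1 : ℝ) ≤ n + 1 := by linarith [Nat.cast_nonneg (α := ℝ) n]
    refine (mul_le_mul_right (hμ _ hn) _).trans ?_
    rw [← ENNReal.ofReal_mul (by positivity)]
    apply ENNReal.ofReal_le_ofReal
    have h1 : ((n : ℝ) + 1) ^ a ≤ ((n : ℝ) + 1) ^ (⌈a⌉₊) := by
      rw [← Real.rpow_natCast]
      exact Real.rpow_le_rpow_of_exponent_le hn (Nat.le_ceil a)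
    calc M / ((n : ℝ) + 1) ^ k * (C * ((n : ℝ) + 1) ^ a)
        ≤ M / ((n : ℝ) + 1) ^ k * (|C| * ((n : ℝ) + 1) ^ (⌈a⌉₊)) := by
          gcongr
          exact le_abs_self C
      _ = _ := by
          rw [hk, pow_add]
          field_simp
  refine (ENNReal.tsum_le_tsum hterm).trans_lt ?_
  have hs : Summable (fun n : ℕ => M * |C| * (1 / ((n : ℝ) + 1) ^ 2)) := by
    have := (summable_nat_add_iff 1).2 (Real.summable_one_div_nat_pow.2 (by norm_num : 1 < 2))
    push_cast at this
    exact this.mul_left _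
  exact hs.tsum_ofReal_lt_top

lemma hx_bdd (η : CMeasure ℝ) (T : SchwartzMap ℝ ℂ →L[ℂ] ℂ) (K : ℝ) (hK : ∀ f, ‖T f‖ ≤ K * qS f)
    (hη : η.Agrees T) (lam : ℂ) (hl : ‖lam‖ = 1) (hT : fourierTD T = lam • T)
    (hst : η.IsStronglyTempered) (φ : SchwartzMap ℝ ℂ) : IsBddFun (convTD T φ) := by
  obtain ⟨C, a, hCa⟩ := hst
  set g0 := transRefl 0 (SchwartzMap.fourierTransformCLM ℂ φ) with hg0
  have hfin := hx_tempered_int η.tv C a hCa g0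
  set M := ∫⁻ x, ‖g0 x‖ₑ ∂η.tv
  refine ⟨M.toReal, fun x => ?_⟩
  set g := SchwartzMap.fourierTransformCLM ℂ (transRefl x φ) with hg
  have h1 : ‖convTD T φ x‖ = ‖T g‖ := by
    have h2 : fourierTD T (transRefl x φ) = T g := rfl
    rw [hT] at h2
    rw [← h2]
    change _ = ‖lam * T (transRefl x φ)‖
    rw [norm_mul, hl, one_mul]
    rfl
  rw [h1]
  obtain ⟨h, hc, hle, hlim⟩ := hx_cutoff g
  have hb : ∀ N, ‖T (h N)‖ ≤ M.toReal := by
    intro N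
    rw [hη _ (hc N)]
    have e1 : ‖η.pairing (h N)‖ₑ ≤ M := by
      unfold CMeasure.pairing
      refine (enorm_integral_le_lintegral_enorm _).trans ?_
      refine lintegral_mono_ae ?_
      filter_upwards [η.density_norm] with s hs
      rw [← ofReal_norm_eq_enorm, ← ofReal_norm_eq_enorm]
      apply ENNReal.ofReal_le_ofReal
      rw [norm_mul, hs, mul_one]
      refine (hle N s).trans ?_
      rw [hg, hx_fourier_transRefl, hg0, transRefl_apply, zero_sub]
    have := ENNReal.toReal_mono hfin.ne e1
    simpa using this
  have hb2 : ∀ N, ‖T g‖ ≤ M.toReal + K * qS (h N - g) := by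
    intro N
    have e1 := hK (h N - g)
    rw [map_sub] at e1
    have e2 := norm_sub_norm_le (T g) (T (h N))
    rw [norm_sub_rev] at e2
    linarith [hb N]
  have hl2 : Tendsto (fun N => M.toReal + K * qS (h N - g)) atTop (𝓝 (M.toReal + K * 0)) :=
    tendsto_const_nhds.add (hlim.const_mul K)
  have := ge_of_tendsto' hl2 hb2
  simpa using this

end Helpers6

section Helpers7

lemma hx_bs (b : ℕ → ℝ → ℂ) (Q : ℝ → ℝ) (hQ : ∀ n x, ‖b n x‖ ≤ Q x)
    (hb : ∀ n : ℕ, ∃ x, (n : ℝ) ≤ ‖b n x‖) :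
    ∃ a : ℕ → ℂ, Summable (fun n => ‖a n‖) ∧ ¬ ∃ C : ℝ, ∀ x, ‖∑' n, a n * b n x‖ ≤ C := by
  by_contra hcon
  push Not at hcon
  have hs : ∀ a : lp (fun _ : ℕ => ℂ) 1, HasSum (fun n => ‖a n‖) ‖a‖ := by
    intro a
    have := lp.hasSum_norm (p := 1) (by simp) a
    simpa using this
  have hsb : ∀ (a : lp (fun _ : ℕ => ℂ) 1) (x : ℝ), Summable (fun n => a n * b n x) := by
    intro a x
    refine Summable.of_norm_bounded ((hs a).summable.mul_right (Q x)) fun n => ?_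
    rw [norm_mul]
    exact mul_le_mul_of_nonneg_left (hQ n x) (norm_nonneg _)
  let L : ℝ → (lp (fun _ : ℕ => ℂ) 1 →ₗ[ℂ] ℂ) := fun x =>
    { toFun := fun a => ∑' n, a n * b n x
      map_add' := fun a c => by
        rw [← (hsb a x).tsum_add (hsb c x)]
        congr 1
        funext n
        simp only [lp.coeFn_add, Pi.add_apply]
        ring
      map_smul' := fun c a => by
        simp only [RingHom.id_apply, smul_eq_mul]
        rw [← tsum_mul_left]
        congr 1
        funext n
        simp only [lp.coeFn_smul, Pi.smul_apply, smul_eq_mul]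
        ring }
  have hL : ∀ x a, L x a = ∑' n, a n * b n x := fun x a => rfl
  let g : ℝ → (lp (fun _ : ℕ => ℂ) 1 →L[ℂ] ℂ) := fun x =>
    (L x).mkContinuous (Q x) (fun a => by
      rw [hL, mul_comm]
      refine tsum_of_norm_bounded ((hs a).mul_right (Q x)) fun n => ?_
      rw [norm_mul]
      exact mul_le_mul_of_nonneg_left (hQ n x) (norm_nonneg _))
  obtain ⟨C, hC⟩ := banach_steinhaus (g := g) (fun a => hcon a (hs a).summable)
  obtain ⟨n, hn⟩ := exists_nat_gt C
  obtain ⟨x, hx⟩ := hb n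
  have h1 : g x (lp.single 1 n 1) = b n x := by
    change ∑' m, (lp.single 1 n (1 : ℂ) : lp (fun _ : ℕ => ℂ) 1) m * b m x = b n x
    rw [tsum_eq_single n]
    · rw [lp.single_apply_self, one_mul]
    · intro m hm
      rw [lp.single_apply_ne _ _ _ hm, zero_mul]
  have h2 := (g x).le_opNorm (lp.single 1 n 1)
  rw [h1, lp.norm_single one_pos, norm_one, mul_one] at h2
  linarith [hC x]

lemma hx_assemble (lam : ℂ) (hlam : lam ^ 4 = 1) (hlam1 : ‖lam‖ = 1)
    (φ : SchwartzMap ℝ ℂ) (hφc : IsTestFn φ) (hφ0 : φ ≠ 0) :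
    ∃ (T : SchwartzMap ℝ ℂ →L[ℂ] ℂ) (W : ℝ → ℂ) (K : ℝ), LF W ∧
      (∀ f, IsTestFn f → HasSum (fun s => W s * f s) (T f)) ∧ (∀ f, ‖T f‖ ≤ K * qS f) ∧
      fourierTD T = lam • T ∧ ¬ IsBddFun (convTD T φ) := by
  choose E u hEu huLF hu0 hEF hEq hEx using exists_E lam hlam hlam1 φ hφc hφ0
  obtain ⟨a, ha, hunb⟩ := hx_bs (fun n x => convTD (E n) φ x) (fun x => qS (transRefl x φ))
    (fun n x => hEq n _) hEx
  have hbd : ∀ f n, ‖a n * E n f‖ ≤ ‖a n‖ * qS f := by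
    intro f n
    rw [norm_mul]
    exact mul_le_mul_of_nonneg_left (hEq n f) (norm_nonneg _)
  have hsm : ∀ f, Summable (fun n => a n * E n f) := fun f =>
    Summable.of_norm_bounded (ha.mul_right (qS f)) (hbd f)
  let L : SchwartzMap ℝ ℂ →ₗ[ℂ] ℂ :=
    { toFun := fun f => ∑' n, a n * E n f
      map_add' := fun f h => by
        rw [← (hsm f).tsum_add (hsm h)]
        congr 1
        funext n
        rw [map_add]; ring
      map_smul' := fun c f => by
        simp only [RingHom.id_apply, smul_eq_mul]
        rw [← tsum_mul_left]
        congr 1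
        funext n
        rw [map_smul, smul_eq_mul]; ring }
  have hLb : ∀ f, ‖L f‖ ≤ (∑' n, ‖a n‖) * qS f := fun f =>
    tsum_of_norm_bounded (ha.hasSum.mul_right (qS f)) (hbd f)
  obtain ⟨T, hT⟩ := hx_mkCLM L _ hLb
  have hT' : ∀ f, T f = ∑' n, a n * E n f := fun f => hT f
  let W : ℝ → ℂ := fun s => ∑ n ∈ Finset.range (⌈|s|⌉₊), a n * u n s
  have hWN : ∀ (N : ℕ) (s : ℝ), |s| ≤ N → W s = ∑ n ∈ Finset.range N, a n * u n s := by
    intro N s hs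
    refine Finset.sum_subset ?_ ?_
    · exact Finset.range_mono (Nat.ceil_le.2 hs)
    · intro n _ hn
      rw [Finset.mem_range, not_lt] at hn
      rw [hu0 n s (Nat.ceil_le.1 hn), mul_zero]
  refine ⟨T, W, _, ?_, ?_, fun f => (hT f) ▸ hLb f, ?_, ?_⟩
  · intro r
    obtain ⟨N, hN⟩ := exists_nat_ge r
    have h1 : LF (fun s => ∑ n ∈ Finset.range N, a n * u n s) :=
      LF.sum _ _ fun n _ => (huLF n).mul (fun _ => a n)
    refine (h1 r).subset ?_
    rintro s ⟨h2, h3⟩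
    exact ⟨h2, fun h4 => h3 ((hWN N s (h2.trans hN)).trans h4)⟩
  · intro f hf
    obtain ⟨R, hR⟩ := hx_supp f hf
    obtain ⟨N, hN⟩ := exists_nat_ge R
    have hE0 : ∀ n, N ≤ n → E n f = 0 := by
      intro n hn
      refine (hEu n f).unique ?_
      have : (fun s => u n s * f s) = fun _ => 0 := by
        funext s
        by_cases h : f s = 0
        · rw [h, mul_zero]
        · rw [hu0 n s ((hR s h).trans (hN.trans (by exact_mod_cast hn))), zero_mul]
      rw [this]
      exact hasSum_zero
    have h1 : T f = ∑ n ∈ Finset.range N, a n * E n f := by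
      rw [hT', tsum_eq_sum]
      intro n hn
      rw [Finset.mem_range, not_lt] at hn
      rw [hE0 n hn, mul_zero]
    rw [h1]
    have h2 : HasSum (fun s => ∑ n ∈ Finset.range N, a n * (u n s * f s))
        (∑ n ∈ Finset.range N, a n * E n f) :=
      hasSum_sum fun n _ => (hEu n f).mul_left (a n)
    have h3 : (fun s => W s * f s) = fun s => ∑ n ∈ Finset.range N, a n * (u n s * f s) := by
      funext s
      by_cases h : f s = 0
      · simp [h]
      · rw [hWN N s ((hR s h).trans hN), Finset.sum_mul]
        exact Finset.sum_congr rfl fun n _ => by ring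
    rw [h3]
    exact h2
  · ext f
    change T (SchwartzMap.fourierTransformCLM ℂ f) = lam * T f
    rw [hT', hT', ← tsum_mul_left]
    congr 1
    funext n
    have : fourierTD (E n) f = lam * E n f := by rw [hEF n]; rfl
    have h2 : E n (SchwartzMap.fourierTransformCLM ℂ f) = lam * E n f := this
    rw [h2]; ring
  · rintro ⟨C, hC⟩
    refine hunb ⟨C, fun x => ?_⟩
    have := hC x
    have h2 : convTD T φ x = ∑' n, a n * convTD (E n) φ x := hT' _
    rwa [h2] at this

end Helpers7

/-- For every eigenvalue `λ ∈ {1,-1,i,-i}` and every non-vanishing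
`φ ∈ C_c^∞(ℝ)`, there are `y ∈ ℝ` and a crystalline Fourier eigenmeasure `η` with
`η̂ = λη` such that, for `ψ(x) = e^{2πixy}φ(x)`, the convolution `η*ψ` is not Bohr
almost periodic. Consequently `η` is not strongly almost periodic as a distribution, not
translation bounded as a distribution, and not a strongly tempered measure. -/
theorem exists_crystalline_eigenmeasure_not_sapD
    (lam : ℂ) (hlam : lam = 1 ∨ lam = -1 ∨ lam = Complex.I ∨ lam = -Complex.I)
    (φ : SchwartzMap ℝ ℂ) (hφc : IsTestFn φ) (hφ0 : φ ≠ 0) :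
    ∃ (y : ℝ) (η ν : CMeasure ℝ) (T : SchwartzMap ℝ ℂ →L[ℂ] ℂ),
      η.Agrees T ∧ ν.Agrees (fourierTD T) ∧
      η.IsPurePoint ∧ ν.IsPurePoint ∧
      η.LocallyFiniteSupport ∧ ν.LocallyFiniteSupport ∧
      fourierTD T = lam • T ∧
      (∀ ψ : SchwartzMap ℝ ℂ,
        (∀ x : ℝ, ψ x = Complex.exp (((2 * Real.pi * x * y : ℝ) : ℂ) * Complex.I) * φ x) →
        ¬ IsBohrAP (convTD T ψ)) ∧
      ¬ SAPD T ∧ ¬ TransBddD T ∧ ¬ η.IsStronglyTempered := by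
  have hl4 : lam ^ 4 = 1 := by
    rcases hlam with rfl | rfl | rfl | rfl
    · norm_num
    · norm_num
    · exact Complex.I_pow_four
    · rw [Even.neg_pow (by decide)]; exact Complex.I_pow_four
  have hl1 : ‖lam‖ = 1 := by
    rcases hlam with rfl | rfl | rfl | rfl <;> simp
  obtain ⟨T, W, K, hW, hTW, hK, hF, hunb⟩ := hx_assemble lam hl4 hl1 φ hφc hφ0
  obtain ⟨η, h1, h2, h3⟩ := hx_measure W hW
  obtain ⟨ν, k1, k2, k3⟩ := hx_measure _ (hW.mul (fun _ => lam))
  have hη : η.Agrees T := fun f hf => (hTW f hf).unique (h3 f hf)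
  refine ⟨0, η, ν, T, hη, ?_, h1, k1, h2, k2, hF, ?_, ?_, ?_, ?_⟩
  · intro f hf
    rw [hF]
    refine HasSum.unique ?_ (k3 f hf)
    have h4 := (hTW f hf).mul_left lam
    have h5 : (fun s => lam * W s * f s) = fun s => lam * (W s * f s) := by
      funext s; ring
    rw [h5]
    exact h4
  · intro ψ hψ
    have : ψ = φ := by
      ext x
      rw [hψ x]
      simp
    rw [this]
    exact fun h => hunb h.2.1
  · exact fun h => hunb (h φ hφc).2.1
  · exact fun h => hunb (h φ hφc)
  · exact fun h => hunb (hx_bdd η T K hK hη lam hl1 hF h φ)
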